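/- arXiv:math/0702192 — 2 statements merged into one kernel-verified Lean document; each statement's English description precedes it below -/
import Mathlib

section
/- Suppose θ has the NOF property. Then for all u,v ∈ ι(θ) with u ≤ v, the Möbius function of the (finite) interval [u,v] of the poset Br(ι(θ)) satisfies: μ(u,v) = (−1)^{ρ(v)−ρ(u)} if the interval [u,v] is full, and μ(u,v) = 0 otherwise. (This is the Möbius-function content of the theorem that under the NOF property every full open interval of Br(ι(θ)) is a PL sphere of dimension ρ(v)−ρ(u)−2 and every non-full open interval is Z-acyclic.) -/
namespace TwistedIdentitiesPaper

open scoped Classical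

variable {B : Type*} {W : Type*} [Group W] {M : CoxeterMatrix B}

/-- The Bruhat order on `W`, defined via the subword property: `u ≤ v` iff every
reduced expression for `v` contains a subword representing `u`. -/
def bruhatLE (cs : CoxeterSystem M W) (u v : W) : Prop :=
  ∀ l : List B, cs.IsReduced l → cs.wordProd l = v →
    ∃ l' : List B, l'.Sublist l ∧ cs.wordProd l' = u

/-- The strict Bruhat order. -/
def bruhatLT (cs : CoxeterSystem M W) (u v : W) : Prop :=
  bruhatLE cs u v ∧ u ≠ v

/-- The action `w ↦ w ⋅ s̲ᵢ`: `w ⋅ s̲ᵢ = w sᵢ` if `θ(sᵢ) w sᵢ = w`, and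
`w ⋅ s̲ᵢ = θ(sᵢ) w sᵢ` otherwise. -/
noncomputable def twistAct (cs : CoxeterSystem M W) (θ : W ≃* W) (w : W) (i : B) : W :=
  if θ (cs.simple i) * w * cs.simple i = w then w * cs.simple i
  else θ (cs.simple i) * w * cs.simple i

/-- `e ⋅ s̲₁ ⋯ s̲ₖ` for a word `s₁ ⋯ sₖ`. -/
noncomputable def twistProd (cs : CoxeterSystem M W) (θ : W ≃* W) (l : List B) : W :=
  l.foldl (twistAct cs θ) 1

/-- The set of twisted involutions `I(θ) = {w : θ(w) = w⁻¹}`. -/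
def twistedInvolutions (θ : W ≃* W) : Set W := {w | θ w = w⁻¹}

/-- The set of twisted identities `ι(θ) = {θ(w⁻¹) w : w ∈ W}`. -/
def twistedIdentities (θ : W ≃* W) : Set W := {w | ∃ v : W, w = θ v⁻¹ * v}

/-- The rank `ρ(w)` of a twisted involution: the least `k` such that
`w = e ⋅ s̲₁ ⋯ s̲ₖ`. -/
noncomputable def twistRank (cs : CoxeterSystem M W) (θ : W ≃* W) (w : W) : ℕ :=
  sInf {k | ∃ l : List B, l.length = k ∧ twistProd cs θ l = w}

/-- `θ` has the no-odd-flip (NOF) property: for every `s ∈ S` with `θ(s) ≠ s`,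
the order of `s θ(s)` is even or infinite. -/
def NOF (cs : CoxeterSystem M W) (θ : W ≃* W) : Prop :=
  ∀ i : B, θ (cs.simple i) ≠ cs.simple i →
    Even (orderOf (cs.simple i * θ (cs.simple i))) ∨
      orderOf (cs.simple i * θ (cs.simple i)) = 0

/-- The interval `[u,v]` of `Br(ι(θ))` is full if it contains no twisted involution
which is not a twisted identity. -/
def IsFull (cs : CoxeterSystem M W) (θ : W ≃* W) (u v : W) : Prop :=
  ∀ w : W, w ∈ twistedInvolutions θ → bruhatLE cs u w → bruhatLE cs w v →
    w ∈ twistedIdentities θ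

/-- The involution `(t, ε) ↦ (a t a⁻¹, ε + [t = a])` attached to an involution `a`. -/
noncomputable def signPerm (a : W) (ha : a * a = 1) : Equiv.Perm (W × ZMod 2) where
  toFun p := (a * p.1 * a, p.2 + if p.1 = a then 1 else 0)
  invFun p := (a * p.1 * a, p.2 + if p.1 = a then 1 else 0)
  left_inv := by
    rintro ⟨t, ε⟩
    have h : a * (a * t * a) * a = t := by
      rw [show a * (a * t * a) * a = (a * a) * t * (a * a) by group, ha]; simp
    have h' : a * t * a = a ↔ t = a := by
      constructor
      · intro h2; rw [h2] at h; rw [← h, ha, one_mul]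
      · rintro rfl; rw [ha, one_mul]
    simp only [h, h', add_assoc, CharTwo.add_self_eq_zero, add_zero]
  right_inv := by
    rintro ⟨t, ε⟩
    have h : a * (a * t * a) * a = t := by
      rw [show a * (a * t * a) * a = (a * a) * t * (a * a) by group, ha]; simp
    have h' : a * t * a = a ↔ t = a := by
      constructor
      · intro h2; rw [h2] at h; rw [← h, ha, one_mul]
      · rintro rfl; rw [ha, one_mul]
    simp only [h, h', add_assoc, CharTwo.add_self_eq_zero, add_zero]

lemma signPerm_apply (a : W) (ha : a * a = 1) (t : W) (ε : ZMod 2) :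
    signPerm a ha (t, ε) = (a * t * a, ε + if t = a then 1 else 0) := rfl

lemma signPerm_mul_pow (a b : W) (ha : a * a = 1) (hb : b * b = 1) (m : ℕ) (t : W) (ε : ZMod 2) :
    ((signPerm a ha * signPerm b hb) ^ m) (t, ε) =
      ((a * b) ^ m * t * ((a * b) ^ m)⁻¹,
        ε + ∑ k ∈ Finset.range (2 * m), if t = b * (a * b) ^ k then 1 else 0) := by
  have ha' : a⁻¹ = a := inv_eq_of_mul_eq_one_left ha
  have hb' : b⁻¹ = b := inv_eq_of_mul_eq_one_left hb
  induction m generalizing t ε with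
  | zero => simp
  | succ m ih =>
    rw [pow_succ, Equiv.Perm.mul_apply, Equiv.Perm.mul_apply, signPerm_apply, signPerm_apply, ih]
    have h1 : ∀ k : ℕ, (a * (b * t * b) * a = b * (a * b) ^ k) ↔ t = b * (a * b) ^ (k + 1 + 1) := by
      intro k
      rw [show a * (b * t * b) * a = (a * b) * t * (a * b)⁻¹ by simp [ha', hb', mul_assoc],
        mul_inv_eq_iff_eq_mul, ← eq_inv_mul_iff_mul_eq, pow_succ, pow_succ']
      simp [ha', hb', mul_assoc]
    have h2 : (b * t * b = a) ↔ t = b * (a * b) ^ (0 + 1) := by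
      rw [← eq_mul_inv_iff_mul_eq, ← eq_inv_mul_iff_mul_eq]
      simp [hb']
    have h3 : (t = b) ↔ t = b * (a * b) ^ 0 := by simp
    ext
    · simp [pow_succ, ha', hb', mul_assoc]
    · rw [show 2 * (m + 1) = 2 * m + 1 + 1 by ring, Finset.sum_range_succ', Finset.sum_range_succ']
      simp only [h1, h2, h3]
      ring

lemma signPerm_isLiftable (cs : CoxeterSystem M W) :
    M.IsLiftable fun i => signPerm (cs.simple i) (cs.simple_mul_simple_self i) := by
  intro i j
  ext1 ⟨t, ε⟩
  rw [signPerm_mul_pow, cs.simple_mul_simple_pow, two_mul, Finset.sum_range_add]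
  simp only [pow_add, cs.simple_mul_simple_pow, one_mul, CharTwo.add_self_eq_zero, add_zero]
  simp

/-- The action of `W` on `W × ZMod 2` extending the involutions `signPerm` of the generators. -/
noncomputable def signHom (cs : CoxeterSystem M W) : W →* Equiv.Perm (W × ZMod 2) :=
  cs.lift ⟨_, signPerm_isLiftable cs⟩

/-- For a reflection `t`, `sgn cs w t` is `1` if `ℓ (w t) < ℓ w` and `0` otherwise. -/
noncomputable def sgn (cs : CoxeterSystem M W) (w t : W) : ZMod 2 := (signHom cs w (t, 0)).2

lemma signHom_simple (cs : CoxeterSystem M W) (i : B) (t : W) (ε : ZMod 2) :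
    signHom cs (cs.simple i) (t, ε) =
      (cs.simple i * t * cs.simple i, ε + if t = cs.simple i then 1 else 0) := by
  rw [signHom, cs.lift_apply_simple]; rfl

lemma signHom_apply (cs : CoxeterSystem M W) (w t : W) (ε : ZMod 2) :
    signHom cs w (t, ε) = (w * t * w⁻¹, ε + sgn cs w t) := by
  unfold sgn
  induction w using cs.simple_induction_left generalizing ε with
  | one => simp
  | mul_simple_left w i ih =>
    rw [map_mul, Equiv.Perm.mul_apply, Equiv.Perm.mul_apply, ih ε, ih 0, signHom_simple,
      signHom_simple]
    simp [mul_assoc, add_assoc]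

lemma sgn_mul (cs : CoxeterSystem M W) (v w t : W) :
    sgn cs (v * w) t = sgn cs w t + sgn cs v (w * t * w⁻¹) := by
  conv_lhs => rw [sgn, map_mul, Equiv.Perm.mul_apply, signHom_apply, signHom_apply]
  simp

@[simp] lemma sgn_one (cs : CoxeterSystem M W) (t : W) : sgn cs 1 t = 0 := by simp [sgn]

lemma sgn_simple (cs : CoxeterSystem M W) (i : B) (t : W) :
    sgn cs (cs.simple i) t = if t = cs.simple i then 1 else 0 := by
  rw [sgn, signHom_simple]; simp

lemma sgn_inv (cs : CoxeterSystem M W) (w t : W) :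
    sgn cs w⁻¹ t = sgn cs w (w⁻¹ * t * w) := by
  have h := sgn_mul cs w w⁻¹ t
  rw [mul_inv_cancel, sgn_one, inv_inv] at h
  exact CharTwo.add_eq_zero.mp h.symm

lemma sgn_self (cs : CoxeterSystem M W) {t : W} (ht : cs.IsReflection t) : sgn cs t t = 1 := by
  obtain ⟨w, i, rfl⟩ := ht
  rw [mul_assoc, sgn_mul, sgn_mul, sgn_inv]
  have h : w⁻¹ * (w * (cs.simple i * w⁻¹)) * w = cs.simple i := by group
  have h' : cs.simple i * w⁻¹ * (w * (cs.simple i * w⁻¹)) * (cs.simple i * w⁻¹)⁻¹ =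
    cs.simple i := by simp [mul_assoc]
  rw [h, h', inv_inv, h, sgn_simple, if_pos rfl, add_right_comm, CharTwo.add_self_eq_zero, zero_add]

lemma mem_rightInvSeq_of_sgn (cs : CoxeterSystem M W) (ω : List B) {t : W}
    (h : sgn cs (cs.wordProd ω) t ≠ 0) : t ∈ cs.rightInvSeq ω := by
  induction ω with
  | nil => simp at h
  | cons i ω ih =>
    rw [cs.wordProd_cons, sgn_mul, sgn_simple] at h
    rw [CoxeterSystem.rightInvSeq, List.mem_cons]
    split_ifs at h with h1
    · left; rw [← h1]; group
    · right; exact ih (by simpa using h)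

lemma exists_eraseIdx_of_sgn (cs : CoxeterSystem M W) (ω : List B) {t : W}
    (h : sgn cs (cs.wordProd ω) t ≠ 0) :
    ∃ j < ω.length, cs.wordProd ω * t = cs.wordProd (ω.eraseIdx j) := by
  obtain ⟨j, hj, rfl⟩ := List.getElem_of_mem (mem_rightInvSeq_of_sgn cs ω h)
  refine ⟨j, by simpa using hj, ?_⟩
  rw [← cs.wordProd_mul_getD_rightInvSeq, List.getD_eq_getElem _ _ hj]

lemma length_lt_of_sgn (cs : CoxeterSystem M W) {w t : W} (h : sgn cs w t ≠ 0) :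
    cs.length (w * t) < cs.length w := by
  obtain ⟨ω, hω, rfl⟩ := cs.exists_isReduced w
  obtain ⟨j, hj, e⟩ := exists_eraseIdx_of_sgn cs ω h
  rw [e, hω]
  refine (cs.length_wordProd_le _).trans_lt ?_
  rw [List.length_eraseIdx_of_lt hj]; omega

lemma sgn_mul_self (cs : CoxeterSystem M W) {w t : W} (ht : cs.IsReflection t) :
    sgn cs (w * t) t = 1 + sgn cs w t := by
  rw [sgn_mul, sgn_self cs ht]; simp

lemma zmod_two_cases (a : ZMod 2) : a = 0 ∨ a = 1 := by
  revert a; decide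

lemma sgn_ne_zero_iff (cs : CoxeterSystem M W) {w t : W} (ht : cs.IsReflection t) :
    sgn cs w t ≠ 0 ↔ cs.length (w * t) < cs.length w := by
  refine ⟨length_lt_of_sgn cs, fun h h0 => ?_⟩
  have h1 := length_lt_of_sgn cs (w := w * t) (t := t) (by rw [sgn_mul_self cs ht, h0]; decide)
  rw [mul_assoc, ht.mul_self, mul_one] at h1
  omega

lemma sgn_eq_zero_iff (cs : CoxeterSystem M W) {w t : W} (ht : cs.IsReflection t) :
    sgn cs w t = 0 ↔ cs.length w < cs.length (w * t) := by
  have h1 := sgn_ne_zero_iff cs (w := w) ht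
  have h2 := ht.length_mul_left_ne w
  rw [ne_eq, not_iff_comm] at h1
  rw [← h1]; omega

lemma isReflection_of_sgn_ne_zero (cs : CoxeterSystem M W) {w t : W} (h : sgn cs w t ≠ 0) :
    cs.IsReflection t := by
  obtain ⟨ω, hω, rfl⟩ := cs.exists_isReduced w
  exact cs.isReflection_of_mem_rightInvSeq ω (mem_rightInvSeq_of_sgn cs ω h)

/-- `x → y` in the Bruhat graph. -/
def BruhatStep (cs : CoxeterSystem M W) (x y : W) : Prop :=
  ∃ t, cs.IsReflection t ∧ y = x * t ∧ cs.length x < cs.length y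

lemma BruhatStep.exists_sublist {cs : CoxeterSystem M W} {x y : W} (h : BruhatStep cs x y)
    (ω : List B) (hω : cs.wordProd ω = y) : ∃ ω' : List B, ω'.Sublist ω ∧ cs.wordProd ω' = x := by
  obtain ⟨t, ht, hxy, hlt⟩ := h
  have hx : x = y * t := by rw [hxy, mul_assoc, ht.mul_self, mul_one]
  rw [hx, ← sgn_ne_zero_iff cs ht, ← hω] at hlt
  obtain ⟨j, -, e⟩ := exists_eraseIdx_of_sgn cs ω hlt
  exact ⟨_, List.eraseIdx_sublist ω j, by rw [← e, hω, hx]⟩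

lemma exists_sublist_of_reflTransGen {cs : CoxeterSystem M W} {u v : W}
    (h : Relation.ReflTransGen (BruhatStep cs) u v) (ω : List B) (hω : cs.wordProd ω = v) :
    ∃ ω' : List B, ω'.Sublist ω ∧ cs.wordProd ω' = u := by
  induction h generalizing ω with
  | refl => exact ⟨ω, List.Sublist.refl ω, hω⟩
  | tail _ hs ih =>
    obtain ⟨ω₁, h₁, e₁⟩ := hs.exists_sublist ω hω
    obtain ⟨ω₂, h₂, e₂⟩ := ih ω₁ e₁
    exact ⟨ω₂, h₂.trans h₁, e₂⟩

lemma BruhatStep.mul_simple {cs : CoxeterSystem M W} {x y : W} (h : BruhatStep cs x y) (i : B) :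
    y = x * cs.simple i ∨ BruhatStep cs (x * cs.simple i) (y * cs.simple i) := by
  obtain ⟨t, ht, rfl, hlt⟩ := h
  by_cases hts : t = cs.simple i
  · exact Or.inl (by rw [hts])
  right
  have ht' : cs.IsReflection (cs.simple i * t * cs.simple i) := by
    simpa using ht.conj (cs.simple i)
  have e : x * t * cs.simple i = x * cs.simple i * (cs.simple i * t * cs.simple i) := by
    simp [mul_assoc]
  refine ⟨_, ht', e, ?_⟩
  rw [e, ← sgn_eq_zero_iff cs ht', sgn_mul, sgn_simple, if_neg, zero_add]
  · rw [← sgn_eq_zero_iff cs ht] at hlt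
    simpa [mul_assoc] using hlt
  · intro h
    apply hts
    have := congrArg (fun z => cs.simple i * z * cs.simple i) h
    simpa [mul_assoc] using this

lemma bruhatStep_mul_simple {cs : CoxeterSystem M W} {x : W} {i : B}
    (h : ¬ cs.IsRightDescent x i) : BruhatStep cs x (x * cs.simple i) := by
  refine ⟨_, cs.isReflection_simple i, rfl, ?_⟩
  rw [cs.not_isRightDescent_iff] at h
  omega

lemma reflTransGen_mul_simple_left {cs : CoxeterSystem M W} {u v : W}
    (h : Relation.ReflTransGen (BruhatStep cs) u v) (i : B) :
    Relation.ReflTransGen (BruhatStep cs) (u * cs.simple i) v ∨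
      Relation.ReflTransGen (BruhatStep cs) (u * cs.simple i) (v * cs.simple i) := by
  induction h using Relation.ReflTransGen.head_induction_on with
  | refl => exact Or.inr .refl
  | head hs hc ih =>
    rcases hs.mul_simple i with rfl | h1
    · exact Or.inl hc
    · exact ih.imp (fun h => h.head h1) (fun h => h.head h1)

lemma reflTransGen_mul_simple_right {cs : CoxeterSystem M W} {u v : W}
    (h : Relation.ReflTransGen (BruhatStep cs) u v) (i : B) :
    Relation.ReflTransGen (BruhatStep cs) u (v * cs.simple i) ∨
      Relation.ReflTransGen (BruhatStep cs) (u * cs.simple i) (v * cs.simple i) := by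
  induction h with
  | refl => exact Or.inr .refl
  | tail hc hs ih =>
    rcases hs.mul_simple i with rfl | h1
    · left; simpa using hc
    · exact ih.imp (fun h => h.tail h1) (fun h => h.tail h1)

lemma isReduced_of_append_left {cs : CoxeterSystem M W} {ω : List B} {i : B}
    (h : cs.IsReduced (ω ++ [i])) :
    cs.IsReduced ω ∧ ¬ cs.IsRightDescent (cs.wordProd ω) i := by
  have h1 : cs.length (cs.wordProd ω * cs.simple i) = ω.length + 1 := by
    have := h
    unfold CoxeterSystem.IsReduced at this
    simpa [cs.wordProd_append] using this
  have h2 := cs.length_wordProd_le ω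
  have h3 := cs.length_mul_simple (cs.wordProd ω) i
  rw [cs.not_isRightDescent_iff]
  unfold CoxeterSystem.IsReduced
  omega

lemma reflTransGen_of_sublist {cs : CoxeterSystem M W} {ω ω' : List B} (hω : cs.IsReduced ω)
    (h : ω'.Sublist ω) :
    Relation.ReflTransGen (BruhatStep cs) (cs.wordProd ω') (cs.wordProd ω) := by
  induction ω using List.reverseRecOn generalizing ω' with
  | nil => rw [List.sublist_nil.mp h]
  | append_singleton ω i ih =>
    obtain ⟨h1, h2⟩ := isReduced_of_append_left hω
    have hs := bruhatStep_mul_simple h2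
    rw [cs.wordProd_append, cs.wordProd_singleton]
    obtain ⟨l₁, l₂, rfl, hl₁, hl₂⟩ := List.sublist_append_iff.mp h
    have hc := ih h1 hl₁
    rcases List.sublist_singleton.mp hl₂ with rfl | rfl
    · simpa using hc.tail hs
    · rw [cs.wordProd_append, cs.wordProd_singleton]
      exact (reflTransGen_mul_simple_left hc i).elim (fun h => h.tail hs) id

lemma bruhatLE_iff (cs : CoxeterSystem M W) {u v : W} :
    bruhatLE cs u v ↔ Relation.ReflTransGen (BruhatStep cs) u v := by
  refine ⟨fun h => ?_, fun h l _ hl => exists_sublist_of_reflTransGen h l hl⟩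
  obtain ⟨ω, hω, rfl⟩ := cs.exists_isReduced v
  obtain ⟨ω', h1, rfl⟩ := h ω hω rfl
  exact reflTransGen_of_sublist hω h1

lemma bruhatLE.refl (cs : CoxeterSystem M W) (u : W) : bruhatLE cs u u :=
  (bruhatLE_iff cs).mpr .refl

lemma bruhatLE.trans {cs : CoxeterSystem M W} {u v w : W} (h : bruhatLE cs u v)
    (h' : bruhatLE cs v w) : bruhatLE cs u w :=
  (bruhatLE_iff cs).mpr (((bruhatLE_iff cs).mp h).trans ((bruhatLE_iff cs).mp h'))

lemma bruhatLE.eq_or_length_lt {cs : CoxeterSystem M W} {u v : W} (h : bruhatLE cs u v) :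
    u = v ∨ cs.length u < cs.length v := by
  rw [bruhatLE_iff] at h
  induction h with
  | refl => exact Or.inl rfl
  | tail _ hs ih =>
    obtain ⟨t, -, -, hlt⟩ := hs
    right
    rcases ih with rfl | h
    · exact hlt
    · exact h.trans hlt

lemma bruhatLE.length_le {cs : CoxeterSystem M W} {u v : W} (h : bruhatLE cs u v) :
    cs.length u ≤ cs.length v := by
  rcases h.eq_or_length_lt with rfl | h
  · exact le_rfl
  · exact h.le

lemma bruhatLE.eq_of_length_le {cs : CoxeterSystem M W} {u v : W} (h : bruhatLE cs u v)
    (h' : cs.length v ≤ cs.length u) : u = v :=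
  h.eq_or_length_lt.resolve_right (by omega)

lemma bruhatLE.antisymm {cs : CoxeterSystem M W} {u v : W} (h : bruhatLE cs u v)
    (h' : bruhatLE cs v u) : u = v :=
  h.eq_of_length_le h'.length_le

lemma bruhatLE.inv {cs : CoxeterSystem M W} {u v : W} (h : bruhatLE cs u v) :
    bruhatLE cs u⁻¹ v⁻¹ := by
  rw [bruhatLE_iff] at h ⊢
  induction h with
  | refl => exact .refl
  | @tail y _ _ hs ih =>
    refine ih.tail ?_
    obtain ⟨t, ht, rfl, hlt⟩ := hs
    refine ⟨_, ht.conj y, ?_, by simpa only [cs.length_inv] using hlt⟩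
    rw [mul_inv_rev, ht.inv]; group

lemma bruhatLE_one_left (cs : CoxeterSystem M W) (v : W) : bruhatLE cs 1 v :=
  fun _ _ _ => ⟨[], List.nil_sublist _, cs.wordProd_nil⟩

lemma bruhatLE_mul_simple {cs : CoxeterSystem M W} {x : W} {i : B}
    (h : ¬ cs.IsRightDescent x i) : bruhatLE cs x (x * cs.simple i) :=
  (bruhatLE_iff cs).mpr (.single (bruhatStep_mul_simple h))

lemma isRightDescent_mul_simple_iff (cs : CoxeterSystem M W) (x : W) (i : B) :
    cs.IsRightDescent (x * cs.simple i) i ↔ ¬ cs.IsRightDescent x i := by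
  have h := cs.length_mul_simple x i
  unfold CoxeterSystem.IsRightDescent
  rw [cs.simple_mul_simple_cancel_right]
  omega

lemma mul_simple_bruhatLE {cs : CoxeterSystem M W} {x : W} {i : B}
    (h : cs.IsRightDescent x i) : bruhatLE cs (x * cs.simple i) x := by
  have h1 := bruhatLE_mul_simple (cs := cs) (x := x * cs.simple i) (i := i)
    (by rw [isRightDescent_mul_simple_iff]; exact not_not.mpr h)
  simpa using h1

lemma finite_setOf_bruhatLE (cs : CoxeterSystem M W) (v : W) : {u | bruhatLE cs u v}.Finite := by
  obtain ⟨ω, hω, rfl⟩ := cs.exists_isReduced v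
  refine ((List.finite_toSet ω.sublists).image cs.wordProd).subset ?_
  intro u hu
  obtain ⟨ω', h1, rfl⟩ := hu ω hω rfl
  exact ⟨ω', by simpa using h1, rfl⟩

/-- The larger of `x` and `x sᵢ`. -/
noncomputable def rightUp (cs : CoxeterSystem M W) (x : W) (i : B) : W :=
  if cs.IsRightDescent x i then x else x * cs.simple i

/-- The smaller of `x` and `x sᵢ`. -/
noncomputable def rightDown (cs : CoxeterSystem M W) (x : W) (i : B) : W :=
  if cs.IsRightDescent x i then x * cs.simple i else x

lemma bruhatLE.rightUp {cs : CoxeterSystem M W} {u v : W} (h : bruhatLE cs u v) (i : B) :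
    bruhatLE cs (rightUp cs u i) (rightUp cs v i) := by
  have hv : bruhatLE cs v (TwistedIdentitiesPaper.rightUp cs v i) := by
    unfold TwistedIdentitiesPaper.rightUp
    split_ifs with h1
    · exact .refl cs v
    · exact bruhatLE_mul_simple h1
  have hvs : bruhatLE cs (v * cs.simple i) (TwistedIdentitiesPaper.rightUp cs v i) := by
    unfold TwistedIdentitiesPaper.rightUp
    split_ifs with h1
    · exact mul_simple_bruhatLE h1
    · exact .refl cs _
  rw [TwistedIdentitiesPaper.rightUp]
  split_ifs with h1
  · exact h.trans hv
  · rcases reflTransGen_mul_simple_left ((bruhatLE_iff cs).mp h) i with h2 | h2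
    · exact ((bruhatLE_iff cs).mpr h2).trans hv
    · exact ((bruhatLE_iff cs).mpr h2).trans hvs

lemma bruhatLE.rightDown {cs : CoxeterSystem M W} {u v : W} (h : bruhatLE cs u v) (i : B) :
    bruhatLE cs (rightDown cs u i) (rightDown cs v i) := by
  have hu : bruhatLE cs (TwistedIdentitiesPaper.rightDown cs u i) u := by
    unfold TwistedIdentitiesPaper.rightDown
    split_ifs with h1
    · exact mul_simple_bruhatLE h1
    · exact .refl cs u
  have hus : bruhatLE cs (TwistedIdentitiesPaper.rightDown cs u i) (u * cs.simple i) := by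
    unfold TwistedIdentitiesPaper.rightDown
    split_ifs with h1
    · exact .refl cs _
    · exact bruhatLE_mul_simple h1
  rw [TwistedIdentitiesPaper.rightDown.eq_1 cs v i]
  split_ifs with h1
  · rcases reflTransGen_mul_simple_right ((bruhatLE_iff cs).mp h) i with h2 | h2
    · exact hu.trans ((bruhatLE_iff cs).mpr h2)
    · exact hus.trans ((bruhatLE_iff cs).mpr h2)
  · exact hu.trans h

/-- The exchange condition for multiplication on both sides. -/
lemma length_mul_mul_simple_lt_iff (cs : CoxeterSystem M W) {r x : W} {i : B}
    (hr : cs.IsReflection r) (h : r * x * cs.simple i ≠ x) :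
    cs.length (r * x * cs.simple i) < cs.length (x * cs.simple i) ↔
      cs.length (r * x) < cs.length x := by
  have h1 : cs.IsReflection (x⁻¹ * r * x) := by simpa using hr.conj x⁻¹
  have h2 : cs.IsReflection (cs.simple i * (x⁻¹ * r * x) * cs.simple i) := by
    simpa using h1.conj (cs.simple i)
  have e1 : r * x = x * (x⁻¹ * r * x) := by group
  have e2 : r * x * cs.simple i =
      (x * cs.simple i) * (cs.simple i * (x⁻¹ * r * x) * cs.simple i) := by
    simp [mul_assoc]
  rw [e2, e1, ← sgn_ne_zero_iff cs h1, ← sgn_ne_zero_iff cs h2, sgn_mul, sgn_simple, if_neg,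
    zero_add]
  · simp [mul_assoc]
  · intro h3
    apply h
    rw [e2, h3]
    simp

/-- `θ` is an involutive automorphism of the Coxeter system. -/
structure IsTwist (cs : CoxeterSystem M W) (θ : W ≃* W) : Prop where
  invol : Function.Involutive θ
  simple : ∀ i, ∃ j, θ (cs.simple i) = cs.simple j

namespace IsTwist

variable {cs : CoxeterSystem M W} {θ : W ≃* W}

lemma length_map_le (h : IsTwist cs θ) (w : W) : cs.length (θ w) ≤ cs.length w := by
  choose σ hσ using h.simple
  obtain ⟨ω, hω, rfl⟩ := cs.exists_isReduced w
  have e : θ (cs.wordProd ω) = cs.wordProd (ω.map σ) := by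
    clear hω
    induction ω with
    | nil => simp
    | cons i ω ih => rw [cs.wordProd_cons, map_mul, ih, hσ, List.map_cons, cs.wordProd_cons]
  rw [e, hω]
  simpa using cs.length_wordProd_le (ω.map σ)

lemma length_map (h : IsTwist cs θ) (w : W) : cs.length (θ w) = cs.length w :=
  (h.length_map_le w).antisymm (by simpa only [h.invol w] using h.length_map_le (θ w))

lemma isReflection_map (h : IsTwist cs θ) {t : W} (ht : cs.IsReflection t) :
    cs.IsReflection (θ t) := by
  obtain ⟨w, i, rfl⟩ := ht
  obtain ⟨j, hj⟩ := h.simple i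
  exact ⟨θ w, j, by simp [hj]⟩

lemma sgn_map (h : IsTwist cs θ) (w t : W) : sgn cs (θ w) (θ t) = sgn cs w t := by
  have key : ∀ w t, sgn cs w t ≠ 0 → sgn cs (θ w) (θ t) ≠ 0 := by
    intro w t h0
    have ht := isReflection_of_sgn_ne_zero cs h0
    rw [sgn_ne_zero_iff cs ht] at h0
    rwa [sgn_ne_zero_iff cs (h.isReflection_map ht), ← map_mul, h.length_map, h.length_map]
  rcases zmod_two_cases (sgn cs w t) with h1 | h1
  · rw [h1]
    by_contra h2
    have h3 := key _ _ h2
    rw [h.invol, h.invol] at h3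
    exact h3 h1
  · have h2 := key w t (by rw [h1]; decide)
    rw [h1]
    exact (zmod_two_cases _).resolve_left h2

end IsTwist

section Involutions

variable {cs : CoxeterSystem M W} {θ : W ≃* W} {x : W} {i : B}

lemma map_simple_mul_self (cs : CoxeterSystem M W) (θ : W ≃* W) (i : B) :
    θ (cs.simple i) * θ (cs.simple i) = 1 := by
  rw [← map_mul, cs.simple_mul_simple_self, map_one]

@[simp] lemma map_simple_mul_cancel_left (cs : CoxeterSystem M W) (θ : W ≃* W) (i : B) (x : W) :
    θ (cs.simple i) * (θ (cs.simple i) * x) = x := by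
  rw [← mul_assoc, map_simple_mul_self, one_mul]

lemma map_simple_inv (cs : CoxeterSystem M W) (θ : W ≃* W) (i : B) :
    (θ (cs.simple i))⁻¹ = θ (cs.simple i) := by
  rw [← map_inv, cs.inv_simple]

lemma twistAct_of_eq (h : θ (cs.simple i) * x * cs.simple i = x) :
    twistAct cs θ x i = x * cs.simple i := if_pos h

lemma twistAct_of_ne (h : θ (cs.simple i) * x * cs.simple i ≠ x) :
    twistAct cs θ x i = θ (cs.simple i) * x * cs.simple i := if_neg h

lemma twistAct_twistAct (cs : CoxeterSystem M W) (θ : W ≃* W) (x : W) (i : B) :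
    twistAct cs θ (twistAct cs θ x i) i = x := by
  by_cases h : θ (cs.simple i) * x * cs.simple i = x
  · rw [twistAct_of_eq h, twistAct_of_eq (by rw [← mul_assoc, h])]
    simp
  · rw [twistAct_of_ne h, twistAct_of_ne]
    · simp [mul_assoc]
    · intro h2
      apply h
      rw [← h2]
      simp [mul_assoc]

lemma conj_mem_twistedInvolutions (h : IsTwist cs θ) (hx : x ∈ twistedInvolutions θ) (w : W) :
    θ w⁻¹ * x * w ∈ twistedInvolutions θ := by
  simp only [twistedInvolutions, Set.mem_ofPred_eq, map_mul, h.invol _, mul_inv_rev] at hx ⊢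
  rw [hx, map_inv]
  group

lemma simple_conj_mem_twistedInvolutions (h : IsTwist cs θ) (hx : x ∈ twistedInvolutions θ)
    (i : B) : θ (cs.simple i) * x * cs.simple i ∈ twistedInvolutions θ := by
  simpa using conj_mem_twistedInvolutions h hx (cs.simple i)

lemma mul_simple_eq_of_conj_eq (hx : θ (cs.simple i) * x * cs.simple i = x) :
    x * cs.simple i = θ (cs.simple i) * x := by
  conv_rhs => rw [← hx]
  simp [mul_assoc]

lemma twistAct_mem (h : IsTwist cs θ) (hx : x ∈ twistedInvolutions θ) (i : B) :
    twistAct cs θ x i ∈ twistedInvolutions θ := by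
  by_cases h1 : θ (cs.simple i) * x * cs.simple i = x
  · have hx' : θ x = x⁻¹ := hx
    rw [twistAct_of_eq h1, twistedInvolutions, Set.mem_ofPred_eq, mul_simple_eq_of_conj_eq h1,
      map_mul, h.invol, hx', mul_inv_rev, map_simple_inv, ← map_simple_inv, ← mul_inv_rev,
      ← mul_simple_eq_of_conj_eq h1, mul_inv_rev, cs.inv_simple]
  · rw [twistAct_of_ne h1]
    exact simple_conj_mem_twistedInvolutions h hx i

lemma length_map_simple_mul (h : IsTwist cs θ) (hx : x ∈ twistedInvolutions θ) (i : B) :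
    cs.length (θ (cs.simple i) * x) = cs.length (x * cs.simple i) := by
  have hx' : θ x = x⁻¹ := hx
  rw [← h.length_map, map_mul, h.invol, hx', ← cs.length_inv]
  simp

lemma length_conj_simple (h : IsTwist cs θ) (hx : x ∈ twistedInvolutions θ)
    (h1 : θ (cs.simple i) * x * cs.simple i ≠ x) :
    (cs.IsRightDescent x i → cs.length (θ (cs.simple i) * x * cs.simple i) + 2 = cs.length x) ∧
    (¬ cs.IsRightDescent x i →
      cs.length (θ (cs.simple i) * x * cs.simple i) = cs.length x + 2) ∧
    (cs.IsRightDescent (θ (cs.simple i) * x * cs.simple i) i ↔ ¬ cs.IsRightDescent x i) := by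
  obtain ⟨j, hj⟩ := h.simple i
  have e1 := length_map_simple_mul h hx i
  have hr : cs.IsReflection (θ (cs.simple i)) := hj ▸ cs.isReflection_simple j
  have e2 := length_mul_mul_simple_lt_iff cs hr h1
  have e3 := cs.length_mul_simple x i
  have e4 := cs.length_simple_mul (x * cs.simple i) j
  rw [← hj, ← mul_assoc] at e4
  have e5 : θ (cs.simple i) * x * cs.simple i * cs.simple i = θ (cs.simple i) * x := by simp
  unfold CoxeterSystem.IsRightDescent
  rw [e5]
  omega

lemma length_twistAct_of_eq (h1 : θ (cs.simple i) * x * cs.simple i = x) :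
    (cs.IsRightDescent x i → cs.length (twistAct cs θ x i) + 1 = cs.length x) ∧
    (¬ cs.IsRightDescent x i → cs.length (twistAct cs θ x i) = cs.length x + 1) := by
  rw [twistAct_of_eq h1]
  have := cs.length_mul_simple x i
  unfold CoxeterSystem.IsRightDescent
  omega

lemma length_twistAct_of_ne (h : IsTwist cs θ) (hx : x ∈ twistedInvolutions θ)
    (h1 : θ (cs.simple i) * x * cs.simple i ≠ x) :
    (cs.IsRightDescent x i → cs.length (twistAct cs θ x i) + 2 = cs.length x) ∧
    (¬ cs.IsRightDescent x i → cs.length (twistAct cs θ x i) = cs.length x + 2) := by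
  rw [twistAct_of_ne h1]
  exact ⟨(length_conj_simple h hx h1).1, (length_conj_simple h hx h1).2.1⟩

lemma isRightDescent_twistAct_iff (h : IsTwist cs θ) (hx : x ∈ twistedInvolutions θ) :
    cs.IsRightDescent (twistAct cs θ x i) i ↔ ¬ cs.IsRightDescent x i := by
  by_cases h1 : θ (cs.simple i) * x * cs.simple i = x
  · rw [twistAct_of_eq h1, isRightDescent_mul_simple_iff]
  · rw [twistAct_of_ne h1]
    exact (length_conj_simple h hx h1).2.2

lemma length_twistAct_lt (h : IsTwist cs θ) (hx : x ∈ twistedInvolutions θ)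
    (hd : cs.IsRightDescent x i) : cs.length (twistAct cs θ x i) < cs.length x := by
  by_cases h1 : θ (cs.simple i) * x * cs.simple i = x
  · have := (length_twistAct_of_eq h1).1 hd
    omega
  · have := (length_twistAct_of_ne h hx h1).1 hd
    omega

/-- The larger of `x` and `x · s̲ᵢ`. -/
noncomputable def twistUp (cs : CoxeterSystem M W) (θ : W ≃* W) (x : W) (i : B) : W :=
  if cs.IsRightDescent x i then x else twistAct cs θ x i

/-- The smaller of `x` and `x · s̲ᵢ`. -/
noncomputable def twistDown (cs : CoxeterSystem M W) (θ : W ≃* W) (x : W) (i : B) : W :=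
  if cs.IsRightDescent x i then twistAct cs θ x i else x

lemma isRightDescent_inv_iff (cs : CoxeterSystem M W) (y : W) (j : B) :
    cs.IsRightDescent y⁻¹ j ↔ cs.length (cs.simple j * y) < cs.length y := by
  unfold CoxeterSystem.IsRightDescent
  rw [cs.length_inv, ← cs.length_inv (y⁻¹ * cs.simple j)]
  simp

lemma twistUp_eq (h : IsTwist cs θ) (hx : x ∈ twistedInvolutions θ) {j : B}
    (hj : θ (cs.simple i) = cs.simple j) :
    twistUp cs θ x i = (rightUp cs (rightUp cs x i)⁻¹ j)⁻¹ := by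
  have e1 := length_map_simple_mul h hx i
  have e0 := cs.length_mul_simple x i
  rw [twistUp, rightUp, rightUp]
  by_cases hd : cs.IsRightDescent x i
  · simp only [hd, if_true]
    rw [isRightDescent_inv_iff, ← hj, e1,
      if_pos (show cs.length (x * cs.simple i) < cs.length x from hd), inv_inv]
  · simp only [hd, if_false]
    rw [isRightDescent_inv_iff, ← hj, ← mul_assoc]
    by_cases h1 : θ (cs.simple i) * x * cs.simple i = x
    · rw [if_pos, twistAct_of_eq h1, inv_inv]
      rw [h1]
      unfold CoxeterSystem.IsRightDescent at hd
      omega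
    · rw [if_neg, twistAct_of_ne h1]
      · simp [map_simple_inv, mul_assoc]
      · have := (length_conj_simple h hx h1).2.1 hd
        omega

lemma twistDown_eq (h : IsTwist cs θ) (hx : x ∈ twistedInvolutions θ) {j : B}
    (hj : θ (cs.simple i) = cs.simple j) :
    twistDown cs θ x i = (rightDown cs (rightDown cs x i)⁻¹ j)⁻¹ := by
  have e1 := length_map_simple_mul h hx i
  have e0 := cs.length_mul_simple x i
  rw [twistDown, rightDown, rightDown]
  by_cases hd : cs.IsRightDescent x i
  · simp only [hd, if_true]
    rw [isRightDescent_inv_iff, ← hj, ← mul_assoc]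
    by_cases h1 : θ (cs.simple i) * x * cs.simple i = x
    · rw [if_neg, twistAct_of_eq h1, inv_inv]
      rw [h1]
      unfold CoxeterSystem.IsRightDescent at hd
      omega
    · rw [if_pos, twistAct_of_ne h1]
      · simp [map_simple_inv, mul_assoc]
      · have := (length_conj_simple h hx h1).1 hd
        omega
  · simp only [hd, if_false]
    rw [isRightDescent_inv_iff, ← hj, e1,
      if_neg (show ¬ cs.length (x * cs.simple i) < cs.length x from hd), inv_inv]

lemma bruhatLE.twistUp (h : IsTwist cs θ) {u v : W} (hu : u ∈ twistedInvolutions θ)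
    (hv : v ∈ twistedInvolutions θ) (huv : bruhatLE cs u v) (i : B) :
    bruhatLE cs (twistUp cs θ u i) (twistUp cs θ v i) := by
  obtain ⟨j, hj⟩ := h.simple i
  rw [twistUp_eq h hu hj, twistUp_eq h hv hj]
  exact ((huv.rightUp i).inv.rightUp j).inv

lemma bruhatLE.twistDown (h : IsTwist cs θ) {u v : W} (hu : u ∈ twistedInvolutions θ)
    (hv : v ∈ twistedInvolutions θ) (huv : bruhatLE cs u v) (i : B) :
    bruhatLE cs (twistDown cs θ u i) (twistDown cs θ v i) := by
  obtain ⟨j, hj⟩ := h.simple i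
  rw [twistDown_eq h hu hj, twistDown_eq h hv hj]
  exact ((huv.rightDown i).inv.rightDown j).inv

lemma rightDown_bruhatLE (cs : CoxeterSystem M W) (x : W) (i : B) :
    bruhatLE cs (rightDown cs x i) x := by
  unfold rightDown
  split_ifs with h1
  · exact mul_simple_bruhatLE h1
  · exact .refl cs x

lemma twistAct_bruhatLE (h : IsTwist cs θ) (hx : x ∈ twistedInvolutions θ)
    (hd : cs.IsRightDescent x i) : bruhatLE cs (twistAct cs θ x i) x := by
  obtain ⟨j, hj⟩ := h.simple i
  have e : twistAct cs θ x i = TwistedIdentitiesPaper.twistDown cs θ x i := (if_pos hd).symm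
  rw [e, twistDown_eq h hx hj]
  have h1 := (rightDown_bruhatLE cs (rightDown cs x i)⁻¹ j).inv
  rw [inv_inv] at h1
  exact h1.trans (rightDown_bruhatLE cs x i)

lemma bruhatLE_twistAct (h : IsTwist cs θ) (hx : x ∈ twistedInvolutions θ)
    (hd : ¬ cs.IsRightDescent x i) : bruhatLE cs x (twistAct cs θ x i) := by
  have := twistAct_bruhatLE h (twistAct_mem h hx i) ((isRightDescent_twistAct_iff h hx).mpr hd)
  rwa [twistAct_twistAct] at this

lemma twistAct_bruhatLE_of_le (h : IsTwist cs θ) {u v : W} (hu : u ∈ twistedInvolutions θ)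
    (hv : v ∈ twistedInvolutions θ) (huv : bruhatLE cs u v) (hdu : ¬ cs.IsRightDescent u i)
    (hdv : cs.IsRightDescent v i) : bruhatLE cs (twistAct cs θ u i) v := by
  have := huv.twistUp h hu hv i
  rwa [twistUp, twistUp, if_neg hdu, if_pos hdv] at this

lemma bruhatLE_twistAct_of_le (h : IsTwist cs θ) {u v : W} (hu : u ∈ twistedInvolutions θ)
    (hv : v ∈ twistedInvolutions θ) (huv : bruhatLE cs u v) (hdu : ¬ cs.IsRightDescent u i)
    (hdv : cs.IsRightDescent v i) : bruhatLE cs u (twistAct cs θ v i) := by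
  have := huv.twistDown h hu hv i
  rwa [twistDown, twistDown, if_neg hdu, if_pos hdv] at this

lemma twistAct_bruhatLE_twistAct (h : IsTwist cs θ) {u v : W} (hu : u ∈ twistedInvolutions θ)
    (hv : v ∈ twistedInvolutions θ) (huv : bruhatLE cs u v)
    (hd : cs.IsRightDescent u i ↔ cs.IsRightDescent v i) :
    bruhatLE cs (twistAct cs θ u i) (twistAct cs θ v i) := by
  by_cases hdu : cs.IsRightDescent u i
  · have := huv.twistDown h hu hv i
    rwa [twistDown, twistDown, if_pos hdu, if_pos (hd.mp hdu)] at this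
  · have := huv.twistUp h hu hv i
    rwa [twistUp, twistUp, if_neg hdu, if_neg (hd.not.mp hdu)] at this

end Involutions

section Identities

variable {cs : CoxeterSystem M W} {θ : W ≃* W} {x : W} {i : B}

lemma twistedIdentities_subset (h : IsTwist cs θ) :
    twistedIdentities θ ⊆ twistedInvolutions θ := by
  rintro _ ⟨v, rfl⟩
  have := conj_mem_twistedInvolutions h (x := 1) (by simp [twistedInvolutions]) v
  rwa [mul_one] at this

lemma one_mem_twistedIdentities (θ : W ≃* W) : (1 : W) ∈ twistedIdentities θ := ⟨1, by simp⟩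

lemma even_length_of_mem (h : IsTwist cs θ) (hx : x ∈ twistedIdentities θ) :
    Even (cs.length x) := by
  obtain ⟨v, rfl⟩ := hx
  have := cs.length_mul_mod_two (θ v⁻¹) v
  rw [h.length_map, cs.length_inv] at this
  rw [Nat.even_iff, this]
  omega

lemma simple_conj_mem_iff (cs : CoxeterSystem M W) (θ : W ≃* W) (x : W) (i : B) :
    θ (cs.simple i) * x * cs.simple i ∈ twistedIdentities θ ↔ x ∈ twistedIdentities θ := by
  have key : ∀ x, x ∈ twistedIdentities θ →
      θ (cs.simple i) * x * cs.simple i ∈ twistedIdentities θ := by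
    rintro _ ⟨v, rfl⟩
    exact ⟨v * cs.simple i, by simp [mul_assoc]⟩
  refine ⟨fun h => ?_, key x⟩
  have := key _ h
  simpa [mul_assoc] using this

lemma conj_ne_of_isRightDescent (h : IsTwist cs θ) (hx : x ∈ twistedIdentities θ)
    (hd : cs.IsRightDescent x i) : θ (cs.simple i) * x * cs.simple i ≠ x := by
  obtain ⟨v, rfl⟩ := hx
  intro h1
  have hb : θ (v * cs.simple i * v⁻¹) = v * cs.simple i * v⁻¹ := by
    have h2 := mul_simple_eq_of_conj_eq h1
    have h3 := congrArg (fun z => θ v * z * v⁻¹) h2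
    simp only [map_mul, map_inv, mul_assoc, mul_inv_cancel_left, mul_inv_cancel, mul_one] at h3 ⊢
    exact h3.symm
  have hs := (sgn_ne_zero_iff cs (cs.isReflection_simple i)).mpr hd
  apply hs
  rw [sgn_mul, ← hb, h.sgn_map, sgn_inv]
  have e : v⁻¹ * (v * cs.simple i * v⁻¹) * v = cs.simple i := by group
  rw [e, CharTwo.add_self_eq_zero]

lemma twistAct_mem_of_isRightDescent (h : IsTwist cs θ) (hx : x ∈ twistedIdentities θ)
    (hd : cs.IsRightDescent x i) : twistAct cs θ x i ∈ twistedIdentities θ := by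
  rw [twistAct_of_ne (conj_ne_of_isRightDescent h hx hd), simple_conj_mem_iff]
  exact hx

lemma twistAct_mem_iff_of_ne (h1 : θ (cs.simple i) * x * cs.simple i ≠ x) :
    twistAct cs θ x i ∈ twistedIdentities θ ↔ x ∈ twistedIdentities θ := by
  rw [twistAct_of_ne h1, simple_conj_mem_iff]

lemma length_twistAct_add_two (h : IsTwist cs θ) (hx : x ∈ twistedIdentities θ)
    (hd : cs.IsRightDescent x i) : cs.length (twistAct cs θ x i) + 2 = cs.length x :=
  (length_twistAct_of_ne h (twistedIdentities_subset h hx)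
    (conj_ne_of_isRightDescent h hx hd)).1 hd

end Identities

section Dihedral

variable {cs : CoxeterSystem M W} {θ : W ≃* W}

lemma conj_mul_zpow_of_mem_closure {a b : W} (ha : a * a = 1) (hb : b * b = 1) {d : W}
    (hd : d ∈ Subgroup.closure {a, b}) {t : W} (ht : ∃ k : ℤ, t = (a * b) ^ k * a) :
    ∃ k : ℤ, d * t * d⁻¹ = (a * b) ^ k * a := by
  have ha' : a⁻¹ = a := inv_eq_of_mul_eq_one_left ha
  have hb' : b⁻¹ = b := inv_eq_of_mul_eq_one_left hb
  have ka : ∀ k : ℤ, a * (a * b) ^ k * a⁻¹ = (a * b) ^ (-k) := by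
    intro k
    rw [← conj_zpow, zpow_neg, ← inv_zpow]
    congr 1
    rw [mul_inv_rev, ha', hb', ← mul_assoc, ha, one_mul]
  have kb : ∀ k : ℤ, b * (a * b) ^ k * b⁻¹ = (a * b) ^ (-k) := by
    intro k
    rw [← conj_zpow, zpow_neg, ← inv_zpow]
    congr 1
    rw [mul_inv_rev, ha', hb', mul_assoc, mul_assoc, hb, mul_one]
  have genA : ∀ t, (∃ k : ℤ, t = (a * b) ^ k * a) → ∃ k : ℤ, a * t * a⁻¹ = (a * b) ^ k * a := by
    rintro _ ⟨k, rfl⟩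
    exact ⟨-k, by rw [← ka]; group⟩
  have genB : ∀ t, (∃ k : ℤ, t = (a * b) ^ k * a) → ∃ k : ℤ, b * t * b⁻¹ = (a * b) ^ k * a := by
    rintro _ ⟨k, rfl⟩
    refine ⟨-k + -1 + -1, ?_⟩
    have e : b * ((a * b) ^ k * a) * b⁻¹ = (b * (a * b) ^ k * b⁻¹) * (b * a * b⁻¹) := by group
    rw [e, kb, zpow_add, zpow_add, zpow_neg_one, mul_inv_rev, ha', hb']
    simp [mul_assoc, ha]
  have key : ∀ t, (∃ k : ℤ, t = (a * b) ^ k * a) → ∃ k : ℤ, d * t * d⁻¹ = (a * b) ^ k * a := by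
    clear ht t
    induction hd using Subgroup.closure_induction'' with
    | mem x hx =>
      rcases hx with rfl | rfl
      · exact genA
      · exact genB
    | inv_mem x hx =>
      rcases hx with rfl | rfl
      · rwa [ha']
      · rwa [hb']
    | one => simp
    | mul x y _ _ ihx ihy =>
      intro t ht
      have := ihx _ (ihy t ht)
      rwa [show x * (y * t * y⁻¹) * x⁻¹ = x * y * t * (x * y)⁻¹ by group] at this
  exact key t ht

lemma eq_mul_zpow_of_sgn_ne_zero {i j : B} {d : W}
    (hd : d ∈ Subgroup.closure {cs.simple i, cs.simple j}) {t : W} (ht : sgn cs d t ≠ 0) :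
    ∃ k : ℤ, t = (cs.simple i * cs.simple j) ^ k * cs.simple i := by
  have hi := cs.simple_mul_simple_self i
  have hj := cs.simple_mul_simple_self j
  have gen : ∀ x ∈ ({cs.simple i, cs.simple j} : Set W), ∀ t, sgn cs x t ≠ 0 →
      ∃ k : ℤ, t = (cs.simple i * cs.simple j) ^ k * cs.simple i := by
    rintro x (rfl | rfl) t ht
    · rw [sgn_simple] at ht
      exact ⟨0, by simpa using ht⟩
    · rw [sgn_simple] at ht
      exact ⟨-1, by simpa using ht⟩
  induction hd using Subgroup.closure_induction'' generalizing t with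
  | mem x hx => exact gen x hx t ht
  | inv_mem x hx =>
    have : x⁻¹ = x := by rcases hx with rfl | rfl <;> simp
    exact gen x hx t (this ▸ ht)
  | one => simp at ht
  | mul x y _ hy ihx ihy =>
    rw [sgn_mul] at ht
    by_cases h : sgn cs y t = 0
    · rw [h, zero_add] at ht
      have := conj_mul_zpow_of_mem_closure hi hj (inv_mem hy) (ihx ht)
      rwa [show y⁻¹ * (y * t * y⁻¹) * y⁻¹⁻¹ = t by group] at this
    · exact ihy h

lemma exists_minimal_mul (cs : CoxeterSystem M W) (D : Subgroup W) (v : W) :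
    ∃ d ∈ D, ∀ d' ∈ D, cs.length (v * d) ≤ cs.length (v * d') := by
  have hne : {n | ∃ d ∈ D, cs.length (v * d) = n}.Nonempty := ⟨_, 1, D.one_mem, rfl⟩
  obtain ⟨d, hd, e⟩ := Nat.sInf_mem hne
  exact ⟨d, hd, fun d' hd' => e ▸ Nat.sInf_le ⟨d', hd', rfl⟩⟩

lemma eq_one_of_minimal {i j : B} {v e : W}
    (he : e ∈ Subgroup.closure {cs.simple i, cs.simple j})
    (h1 : ∀ d ∈ Subgroup.closure {cs.simple i, cs.simple j}, cs.length v ≤ cs.length (v * d))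
    (h2 : ∀ d ∈ Subgroup.closure {cs.simple i, cs.simple j},
      cs.length (v * e) ≤ cs.length (v * e * d)) : e = 1 := by
  by_contra hne
  obtain ⟨k, hk⟩ := cs.exists_rightDescent_of_ne_one hne
  have hr := cs.isReflection_simple k
  have hs := (sgn_ne_zero_iff cs hr).mpr hk
  obtain ⟨n, hn⟩ := eq_mul_zpow_of_sgn_ne_zero he hs
  have hmem : cs.simple k ∈ Subgroup.closure {cs.simple i, cs.simple j} := by
    have hi : cs.simple i ∈ Subgroup.closure {cs.simple i, cs.simple j} :=
      Subgroup.subset_closure (by simp)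
    have hj : cs.simple j ∈ Subgroup.closure {cs.simple i, cs.simple j} :=
      Subgroup.subset_closure (by simp)
    rw [hn]
    exact mul_mem (zpow_mem (mul_mem hi hj) n) hi
  have h3 : sgn cs (v * e) (cs.simple k) = 0 := by
    by_contra h
    have := length_lt_of_sgn cs h
    have := h2 _ hmem
    omega
  have h4 : sgn cs v (e * cs.simple k * e⁻¹) = 0 := by
    by_contra h
    have := length_lt_of_sgn cs h
    have := h1 _ (mul_mem (mul_mem he hmem) (inv_mem he))
    omega
  rw [sgn_mul, h4, add_zero] at h3
  exact hs h3

end Dihedral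

section FixedReflections

variable {cs : CoxeterSystem M W} {θ : W ≃* W}

lemma exists_simple_of_fixed_mem_dihedral (h : IsTwist cs θ) (hN : NOF cs θ) {i j : B}
    (hj : θ (cs.simple i) = cs.simple j) {t : W} (ht : θ t = t)
    (hk : ∃ k : ℤ, t = (cs.simple i * cs.simple j) ^ k * cs.simple i) :
    θ (cs.simple i) = cs.simple i ∧ t = cs.simple i := by
  have hj' : θ (cs.simple j) = cs.simple i := by rw [← hj, h.invol]
  obtain ⟨k, rfl⟩ := hk
  by_cases hij : cs.simple j = cs.simple i
  · refine ⟨hj.trans hij, ?_⟩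
    rw [hij]; simp
  exfalso
  have e : cs.simple j * cs.simple i = (cs.simple i * cs.simple j)⁻¹ := by simp
  rw [map_mul, map_zpow, map_mul, hj, hj', e, inv_zpow, ← zpow_neg] at ht
  have h1 : (cs.simple i * cs.simple j) ^ (2 * k + 1) = 1 := by
    have h2 : (cs.simple i * cs.simple j) ^ k =
        (cs.simple i * cs.simple j) ^ (-k) * (cs.simple i * cs.simple j)⁻¹ := by
      rw [← e, ← mul_assoc, ht]
      simp
    rw [← zpow_neg_one, ← zpow_add] at h2
    rw [two_mul, add_assoc, zpow_add _ k (k + 1), h2, ← zpow_add, show -k + -1 + (k + 1) = 0 by ring,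
      zpow_zero]
  rw [← orderOf_dvd_iff_zpow_eq_one] at h1
  have h2 : Even (orderOf (cs.simple i * cs.simple j)) := by
    rcases hN i (by rwa [hj]) with h3 | h3
    · rwa [← hj]
    · rw [← hj, h3]; exact Even.zero
  obtain ⟨m, hm⟩ := h2
  obtain ⟨c, hc⟩ := h1
  rw [hm] at hc
  push_cast at hc
  have : 2 * k + 1 = 2 * (m * c) := by rw [hc]; ring
  omega

/-- Under the NOF property every `θ`-fixed reflection is conjugate to a `θ`-fixed simple
reflection by a `θ`-fixed element. -/
lemma exists_conj_of_fixed_reflection (h : IsTwist cs θ) (hN : NOF cs θ) {t : W}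
    (hr : cs.IsReflection t) (ht : θ t = t) :
    ∃ g, θ g = g ∧ ∃ i, θ (cs.simple i) = cs.simple i ∧ t = g * cs.simple i * g⁻¹ := by
  have key : ∀ n (v t : W), cs.length v = n → θ v = v → θ t = t → sgn cs v t ≠ 0 →
      ∃ g, θ g = g ∧ ∃ i, θ (cs.simple i) = cs.simple i ∧ t = g * cs.simple i * g⁻¹ := by
    intro n
    induction n using Nat.strong_induction_on with
    | _ n ih =>
    rintro v t rfl hv ht hs
    have hv1 : v ≠ 1 := by rintro rfl; simp at hs
    obtain ⟨i, hi⟩ := cs.exists_rightDescent_of_ne_one hv1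
    obtain ⟨j, hj⟩ := h.simple i
    have hj' : θ (cs.simple j) = cs.simple i := by rw [← hj, h.invol]
    have hθD : ∀ d ∈ Subgroup.closure {cs.simple i, cs.simple j},
        θ d ∈ Subgroup.closure {cs.simple i, cs.simple j} := by
      intro d hd
      induction hd using Subgroup.closure_induction with
      | mem x hx =>
        apply Subgroup.subset_closure
        rcases hx with rfl | rfl
        · rw [hj]; simp
        · rw [hj']; simp
      | one => simp
      | mul x y _ _ hx hy => rw [map_mul]; exact mul_mem hx hy
      | inv x _ hx => rw [map_inv]; exact inv_mem hx
    obtain ⟨d, hd, hmin⟩ := exists_minimal_mul cs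
      (Subgroup.closure {cs.simple i, cs.simple j}) v
    have he : d⁻¹ * θ d = 1 := by
      refine eq_one_of_minimal (v := v * d) (mul_mem (inv_mem hd) (hθD d hd)) ?_ ?_
      · intro d' hd'
        rw [mul_assoc]
        exact hmin _ (mul_mem hd hd')
      · intro d' hd'
        have e : v * d * (d⁻¹ * θ d) = θ (v * d) := by rw [map_mul, hv]; group
        have e' : v * d * (d⁻¹ * θ d) * d' = v * (θ d * d') := by group
        rw [e', e, h.length_map]
        exact hmin _ (mul_mem (hθD d hd) hd')
    have hd1 : θ d = d := (inv_mul_eq_one.mp he).symm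
    have hlt : cs.length (v * d) < cs.length v :=
      (hmin _ (Subgroup.subset_closure (by simp))).trans_lt hi
    have hs' : sgn cs (v * d * d⁻¹) t ≠ 0 := by simpa using hs
    rw [sgn_mul, inv_inv] at hs'
    by_cases h0 : sgn cs d⁻¹ t = 0
    · rw [h0, zero_add] at hs'
      obtain ⟨g, hg, i, hi, e⟩ := ih _ hlt (v * d) (d⁻¹ * t * d) rfl (by rw [map_mul, hv, hd1])
        (by simp [hd1, ht]) hs'
      refine ⟨d * g, by rw [map_mul, hd1, hg], i, hi, ?_⟩
      rw [show t = d * (d⁻¹ * t * d) * d⁻¹ by group, e]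
      group
    · obtain ⟨h1, rfl⟩ := exists_simple_of_fixed_mem_dihedral h hN hj ht
        (eq_mul_zpow_of_sgn_ne_zero (inv_mem hd) h0)
      exact ⟨1, map_one θ, i, h1, by simp⟩
  exact key _ t t rfl ht ht (by rw [sgn_self cs hr]; decide)

/-- `z = θ(x)⁻¹ x` and `y = θ(x)⁻¹ s x` for some `x` and some `θ`-fixed simple reflection `s`. -/
def IsTwistPair (cs : CoxeterSystem M W) (θ : W ≃* W) (z y : W) : Prop :=
  ∃ (x : W) (k : B), θ (cs.simple k) = cs.simple k ∧ z = θ x⁻¹ * x ∧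
    y = θ x⁻¹ * (cs.simple k * x)

namespace IsTwistPair

variable {z y : W}

lemma left_mem (hp : IsTwistPair cs θ z y) : z ∈ twistedIdentities θ := by
  obtain ⟨x, -, -, hz, -⟩ := hp
  exact ⟨x, hz⟩

lemma right_mem (h : IsTwist cs θ) (hp : IsTwistPair cs θ z y) : y ∈ twistedInvolutions θ := by
  obtain ⟨x, k, hk, -, rfl⟩ := hp
  rw [← mul_assoc]
  exact conj_mem_twistedInvolutions h (by simp [twistedInvolutions, hk]) x

lemma conj (hp : IsTwistPair cs θ z y) (i : B) :
    IsTwistPair cs θ (θ (cs.simple i) * z * cs.simple i) (θ (cs.simple i) * y * cs.simple i) := by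
  obtain ⟨x, k, hk, rfl, rfl⟩ := hp
  exact ⟨x * cs.simple i, k, hk, by simp [mul_assoc], by simp [mul_assoc]⟩

lemma eq_mul_simple (h : IsTwist cs θ) (hp : IsTwistPair cs θ z y) {i : B}
    (hd : cs.IsRightDescent y i) (hy : θ (cs.simple i) * y * cs.simple i = y) :
    y = z * cs.simple i := by
  obtain ⟨x, k, hk, rfl, rfl⟩ := hp
  have hb : θ (x * cs.simple i * x⁻¹) =
      cs.simple k * (x * cs.simple i * x⁻¹) * (cs.simple k)⁻¹ := by
    have h2 := mul_simple_eq_of_conj_eq hy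
    have h3 := congrArg (fun w => θ x * w * x⁻¹ * (cs.simple k)⁻¹) h2
    simp only [map_mul, map_inv, mul_assoc, mul_inv_cancel_left, mul_inv_cancel, mul_one] at h3 ⊢
    exact h3.symm
  have hs := (sgn_ne_zero_iff cs (cs.isReflection_simple i)).mpr hd
  by_cases hbk : x * cs.simple i * x⁻¹ = cs.simple k
  · rw [← hbk]; group
  · exfalso
    apply hs
    have e : x⁻¹ * (x * cs.simple i * x⁻¹) * x = cs.simple i := by group
    have e' : cs.simple k * x * cs.simple i * (cs.simple k * x)⁻¹ =
      cs.simple k * (x * cs.simple i * x⁻¹) * (cs.simple k)⁻¹ := by group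
    rw [sgn_mul, sgn_mul, e', ← hb, h.sgn_map, sgn_inv, e, sgn_simple, if_neg hbk, add_zero,
      CharTwo.add_self_eq_zero]

end IsTwistPair

lemma isTwistPair_of_conj_eq (h : IsTwist cs θ) (hN : NOF cs θ) {z : W} {i : B}
    (hz : z ∈ twistedIdentities θ) (hzi : θ (cs.simple i) * z * cs.simple i = z) :
    IsTwistPair cs θ z (z * cs.simple i) := by
  obtain ⟨x, rfl⟩ := hz
  have hb : θ (x * cs.simple i * x⁻¹) = x * cs.simple i * x⁻¹ := by
    have h2 := mul_simple_eq_of_conj_eq hzi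
    have h3 := congrArg (fun w => θ x * w * x⁻¹) h2
    simp only [map_mul, map_inv, mul_assoc, mul_inv_cancel_left, mul_inv_cancel, mul_one] at h3 ⊢
    exact h3.symm
  obtain ⟨g, hg, k, hk, e⟩ := exists_conj_of_fixed_reflection h hN
    ((cs.isReflection_simple i).conj x) hb
  refine ⟨g⁻¹ * x, k, hk, by simp [hg], ?_⟩
  have e' : cs.simple k = g⁻¹ * (x * cs.simple i * x⁻¹) * g := by rw [e]; group
  rw [e']
  simp [hg, mul_assoc]

end FixedReflections

section Separation

variable {cs : CoxeterSystem M W} {θ : W ≃* W} {z y : W} {i r : B}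

lemma isRightDescent_mul_simple_of_conj_eq (h : IsTwist cs θ) (hN : NOF cs θ)
    (hz : z ∈ twistedIdentities θ) (hi : ¬ cs.IsRightDescent z i)
    (hzi : θ (cs.simple i) * z * cs.simple i = z) (hr : cs.IsRightDescent z r) :
    cs.IsRightDescent (z * cs.simple i) r ∧
      θ (cs.simple r) * (z * cs.simple i) * cs.simple r ≠ z * cs.simple i := by
  have hp := isTwistPair_of_conj_eq h hN hz hzi
  have hI := twistedIdentities_subset h hz
  have hd : cs.IsRightDescent (z * cs.simple i) r := by
    have e1 := length_map_simple_mul h (hp.right_mem h) r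
    have e2 := length_map_simple_mul h hI r
    have e3 := cs.length_mul_simple (θ (cs.simple r) * z) i
    rw [cs.not_isRightDescent_iff] at hi
    rw [mul_assoc] at e3
    unfold CoxeterSystem.IsRightDescent at hr ⊢
    omega
  refine ⟨hd, fun h1 => hi ?_⟩
  have h2 := mul_left_cancel (hp.eq_mul_simple h hd h1)
  unfold CoxeterSystem.IsRightDescent at hr ⊢
  rwa [h2]

lemma bruhatLE_of_twistAct_separated (h : IsTwist cs θ) (hz : z ∈ twistedInvolutions θ)
    (hy : y ∈ twistedInvolutions θ) (hzr : cs.IsRightDescent z r) (hyr : cs.IsRightDescent y r)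
    (hQ : ∀ x ∈ twistedIdentities θ, bruhatLE cs x (twistAct cs θ y r) →
      bruhatLE cs x (twistAct cs θ z r)) :
    ∀ x ∈ twistedIdentities θ, bruhatLE cs x y → bruhatLE cs x z := by
  intro x hx hxy
  have hxI := twistedIdentities_subset h hx
  by_cases hxr : cs.IsRightDescent x r
  · have h1 := hQ _ (twistAct_mem_of_isRightDescent h hx hxr)
      (twistAct_bruhatLE_twistAct h hxI hy hxy (iff_of_true hxr hyr))
    have h2 := twistAct_bruhatLE_of_le h (i := r) (twistAct_mem h hxI r) hz
      (h1.trans (twistAct_bruhatLE h hz hzr))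
      (by rw [isRightDescent_twistAct_iff h hxI]; exact not_not.mpr hxr) hzr
    rwa [twistAct_twistAct] at h2
  · exact (hQ x hx (bruhatLE_twistAct_of_le h hxI hy hxy hxr hyr)).trans
      (twistAct_bruhatLE h hz hzr)

lemma bruhatLE_of_isTwistPair (h : IsTwist cs θ) {i j : B} {w : W} {n : ℕ}
    (hB : ∀ (z : W) (i : B), cs.length z < n → z ∈ twistedIdentities θ →
      ¬ cs.IsRightDescent z i → θ (cs.simple i) * z * cs.simple i = z →
      ∀ x ∈ twistedIdentities θ, bruhatLE cs x (z * cs.simple i) → bruhatLE cs x z)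
    {a b : B} (hab : a = i ∧ b = j ∨ a = j ∧ b = i) (hp : IsTwistPair cs θ z y)
    (hlen : cs.length y = cs.length z + 1) (hza : ¬ cs.IsRightDescent z a)
    (hya : ¬ cs.IsRightDescent y a) (hzw : bruhatLE cs z w) (hyw : bruhatLE cs y w)
    (hzn : cs.length z < n)
    (H : ∀ x ∈ twistedInvolutions θ, ¬ cs.IsRightDescent x i → ¬ cs.IsRightDescent x j →
      bruhatLE cs x w → bruhatLE cs x z ∧ bruhatLE cs x y) :
    ∀ x ∈ twistedIdentities θ, bruhatLE cs x y → bruhatLE cs x z := by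
  induction hm : cs.length z using Nat.strong_induction_on generalizing z y a b with
  | _ m ih =>
  subst hm
  have hz := hp.left_mem
  have hzI := twistedIdentities_subset h hz
  have hyI := hp.right_mem h
  have H' : ∀ x ∈ twistedInvolutions θ, ¬ cs.IsRightDescent x a → ¬ cs.IsRightDescent x b →
      bruhatLE cs x w → bruhatLE cs x z ∧ bruhatLE cs x y := by
    rcases hab with ⟨rfl, rfl⟩ | ⟨rfl, rfl⟩
    · exact H
    · exact fun x hx h1 h2 => H x hx h2 h1
  have hyb : cs.IsRightDescent y b := by
    by_contra hyb
    have := (H' y hyI hya hyb hyw).1.length_le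
    omega
  by_cases hzb : cs.IsRightDescent z b
  · have hz2 := conj_ne_of_isRightDescent h hz hzb
    have hy2 : θ (cs.simple b) * y * cs.simple b ≠ y := by
      intro h1
      have h2 := hp.eq_mul_simple h hyb h1
      have h3 : cs.length (z * cs.simple b) < cs.length z := hzb
      rw [← h2] at h3
      omega
    have lz := (length_twistAct_of_ne h hzI hz2).1 hzb
    have ly := (length_twistAct_of_ne h hyI hy2).1 hyb
    have hp' := hp.conj b
    rw [← twistAct_of_ne hz2, ← twistAct_of_ne hy2] at hp'
    have hzle := twistAct_bruhatLE h hzI hzb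
    have hyle := twistAct_bruhatLE h hyI hyb
    refine bruhatLE_of_twistAct_separated h hzI hyI hzb hyb ?_
    refine ih _ (by omega) (a := b) (b := a) (by tauto) hp' (by omega)
      (by rw [isRightDescent_twistAct_iff h hzI]; exact not_not.mpr hzb)
      (by rw [isRightDescent_twistAct_iff h hyI]; exact not_not.mpr hyb)
      (hzle.trans hzw) (hyle.trans hyw) (by omega) ?_ rfl
    intro x hx h1 h2 hxw
    have hxb : ¬ cs.IsRightDescent x b := by
      rcases hab with ⟨rfl, rfl⟩ | ⟨rfl, rfl⟩ <;> assumption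
    obtain ⟨h3, h4⟩ := H x hx h1 h2 hxw
    exact ⟨bruhatLE_twistAct_of_le h hx hzI h3 hxb hzb,
      bruhatLE_twistAct_of_le h hx hyI h4 hxb hyb⟩
  · by_cases hy2 : θ (cs.simple b) * y * cs.simple b = y
    · have e := hp.eq_mul_simple h hyb hy2
      rw [e]
      refine hB z b hzn hz hzb ?_
      rw [e] at hy2
      simpa [mul_assoc] using congrArg (· * cs.simple b) hy2
    · exfalso
      have ly := (length_twistAct_of_ne h hyI hy2).1 hyb
      have h1 := (H' z hzI hza hzb hzw).2
      have h2 := (bruhatLE_twistAct_of_le h hzI hyI h1 hzb hyb).length_le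
      omega

/-- Under the NOF property, if `z · s̲ = z s` covers the twisted identity `z`, then every twisted
identity below `z s` is below `z`. -/
lemma bruhatLE_of_bruhatLE_mul_simple (h : IsTwist cs θ) (hN : NOF cs θ)
    (hz : z ∈ twistedIdentities θ) (hi : ¬ cs.IsRightDescent z i)
    (hzi : θ (cs.simple i) * z * cs.simple i = z) :
    ∀ x ∈ twistedIdentities θ, bruhatLE cs x (z * cs.simple i) → bruhatLE cs x z := by
  induction hn : cs.length z using Nat.strong_induction_on generalizing z i with
  | _ n ih =>
  subst hn
  by_cases hz1 : z = 1
  · subst hz1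
    intro x hx hxi
    have h1 := hxi.length_le
    have h2 := even_length_of_mem h hx
    rw [one_mul, cs.length_simple] at h1
    have h3 : cs.length x = 0 := by
      rcases h2 with ⟨m, hm⟩
      omega
    rw [cs.length_eq_zero_iff] at h3
    rw [h3]
    exact .refl cs 1
  obtain ⟨j, hzj⟩ := cs.exists_rightDescent_of_ne_one hz1
  obtain ⟨hyj, hy2⟩ := isRightDescent_mul_simple_of_conj_eq h hN hz hi hzi hzj
  have hp := isTwistPair_of_conj_eq h hN hz hzi
  have hz2 := conj_ne_of_isRightDescent h hz hzj
  have hzI := twistedIdentities_subset h hz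
  have hyI := hp.right_mem h
  have hyi : cs.IsRightDescent (z * cs.simple i) i := (isRightDescent_mul_simple_iff cs z i).mpr hi
  have lz := (length_twistAct_of_ne h hzI hz2).1 hzj
  have ly := (length_twistAct_of_ne h hyI hy2).1 hyj
  have hlen := (cs.not_isRightDescent_iff).mp hi
  have hp' := hp.conj j
  rw [← twistAct_of_ne hz2, ← twistAct_of_ne hy2] at hp'
  have hzle := twistAct_bruhatLE h hzI hzj
  have hyle := twistAct_bruhatLE h hyI hyj
  refine bruhatLE_of_twistAct_separated h hzI hyI hzj hyj ?_
  refine bruhatLE_of_isTwistPair h (i := i) (j := j) (n := cs.length z)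
    (fun z i hlt hz hi hzi => ih _ hlt hz hi hzi rfl) (Or.inr ⟨rfl, rfl⟩) hp' (by omega)
    (by rw [isRightDescent_twistAct_iff h hzI]; exact not_not.mpr hzj)
    (by rw [isRightDescent_twistAct_iff h hyI]; exact not_not.mpr hyj)
    (hzle.trans (bruhatLE_mul_simple hi)) hyle (by omega) ?_
  intro x hx hxi hxj hxy
  have h1 := bruhatLE_twistAct_of_le h hx hyI hxy hxi hyi
  rw [← twistAct_of_eq hzi, twistAct_twistAct] at h1
  exact ⟨bruhatLE_twistAct_of_le h hx hzI h1 hxj hzj,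
    bruhatLE_twistAct_of_le h hx hyI hxy hxj hyj⟩

lemma twistAct_notMem_of_isRightDescent (h : IsTwist cs θ) (hy : y ∈ twistedInvolutions θ)
    (hy' : y ∉ twistedIdentities θ) (hd : ¬ cs.IsRightDescent y i) :
    twistAct cs θ y i ∉ twistedIdentities θ := by
  intro h1
  apply hy'
  have := twistAct_mem_of_isRightDescent h h1 ((isRightDescent_twistAct_iff h hy).mpr hd)
  rwa [twistAct_twistAct] at this

lemma eq_of_twistAct_mem (hy' : y ∉ twistedIdentities θ)
    (h1 : twistAct cs θ y i ∈ twistedIdentities θ) :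
    θ (cs.simple i) * y * cs.simple i = y := by
  by_contra h2
  exact hy' ((twistAct_mem_iff_of_ne h2).mp h1)

/-- If `y` is not a twisted identity but `z = y · s̲ < y` is, then `y = z s` is a cover of `z`. -/
lemma twistAct_of_mem_of_notMem (h : IsTwist cs θ) (hy : y ∈ twistedInvolutions θ)
    (hy' : y ∉ twistedIdentities θ) (hd : cs.IsRightDescent y i)
    (h1 : twistAct cs θ y i ∈ twistedIdentities θ) :
    ¬ cs.IsRightDescent (twistAct cs θ y i) i ∧
      θ (cs.simple i) * twistAct cs θ y i * cs.simple i = twistAct cs θ y i ∧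
      y = twistAct cs θ y i * cs.simple i := by
  have h2 := eq_of_twistAct_mem hy' h1
  refine ⟨by rw [isRightDescent_twistAct_iff h hy]; exact not_not.mpr hd, ?_, ?_⟩
  · rw [twistAct_of_eq h2, ← mul_assoc, h2]
  · rw [twistAct_of_eq h2]; simp

/-- Below a twisted involution `y` that is not a twisted identity and above a twisted identity
`u ≤ y` there is such a twisted involution for which `u` is the greatest twisted identity below. -/
lemma exists_separating (h : IsTwist cs θ) (hN : NOF cs θ) {u : W}
    (hy : y ∈ twistedInvolutions θ) (hy' : y ∉ twistedIdentities θ)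
    (hu : u ∈ twistedIdentities θ) (huy : bruhatLE cs u y) :
    ∃ w ∈ twistedInvolutions θ, w ∉ twistedIdentities θ ∧ bruhatLE cs u w ∧ bruhatLE cs w y ∧
      ∀ x ∈ twistedIdentities θ, bruhatLE cs x w → bruhatLE cs x u := by
  induction hn : cs.length y using Nat.strong_induction_on generalizing u y with
  | _ n ih =>
  subst hn
  have huI := twistedIdentities_subset h hu
  by_cases hex : ∃ r, cs.IsRightDescent y r ∧ twistAct cs θ y r ∉ twistedIdentities θ
  · obtain ⟨r, hyr, hr⟩ := hex
    have hlt := length_twistAct_lt h hy hyr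
    have hle := twistAct_bruhatLE h hy hyr
    by_cases hur : cs.IsRightDescent u r
    · have huI' := twistAct_mem h huI r
      have hur' : ¬ cs.IsRightDescent (twistAct cs θ u r) r := by
        rw [isRightDescent_twistAct_iff h huI]; exact not_not.mpr hur
      obtain ⟨w, hw, hw', huw, hwy, hQ⟩ := ih _ hlt (twistAct_mem h hy r) hr
        (twistAct_mem_of_isRightDescent h hu hur)
        (twistAct_bruhatLE_twistAct h huI hy huy (iff_of_true hur hyr)) rfl
      by_cases hwr : cs.IsRightDescent w r
      · have h1 := twistAct_bruhatLE_of_le h huI' hw huw hur' hwr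
        rw [twistAct_twistAct] at h1
        exact ⟨w, hw, hw', h1, hwy.trans hle,
          fun x hx hxw => (hQ x hx hxw).trans (twistAct_bruhatLE h huI hur)⟩
      · have hwr' := (isRightDescent_twistAct_iff h hw).mpr hwr
        have h1 := twistAct_bruhatLE_twistAct h huI' hw huw (iff_of_false hur' hwr)
        rw [twistAct_twistAct] at h1
        refine ⟨twistAct cs θ w r, twistAct_mem h hw r,
          twistAct_notMem_of_isRightDescent h hw hw' hwr, h1,
          twistAct_bruhatLE_of_le h hw hy (hwy.trans hle) hwr hyr,
          bruhatLE_of_twistAct_separated h huI (twistAct_mem h hw r) hur hwr' ?_⟩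
        rwa [twistAct_twistAct]
    · obtain ⟨w, hw, hw', huw, hwy, hQ⟩ := ih _ hlt (twistAct_mem h hy r) hr hu
        (bruhatLE_twistAct_of_le h huI hy huy hur hyr) rfl
      exact ⟨w, hw, hw', huw, hwy.trans hle, hQ⟩
  · push Not at hex
    have hy1 : y ≠ 1 := by
      rintro rfl
      exact hy' (one_mem_twistedIdentities θ)
    obtain ⟨i, hi⟩ := cs.exists_rightDescent_of_ne_one hy1
    have hz := hex i hi
    obtain ⟨h1, h2, h3⟩ := twistAct_of_mem_of_notMem h hy hy' hi hz
    have hz1 : twistAct cs θ y i = 1 := by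
      by_contra hne
      obtain ⟨r, hr⟩ := cs.exists_rightDescent_of_ne_one hne
      obtain ⟨h4, h5⟩ := isRightDescent_mul_simple_of_conj_eq h hN hz h1 h2 hr
      rw [← h3] at h4 h5
      exact h5 (eq_of_twistAct_mem hy' (hex r h4))
    have hB := bruhatLE_of_bruhatLE_mul_simple h hN hz h1 h2
    rw [← h3, hz1] at hB
    have hu1 : u = 1 := (hB u hu huy).antisymm (bruhatLE_one_left cs u)
    subst hu1
    exact ⟨y, hy, hy', huy, .refl cs y, hB⟩

end Separation

section Mobius

variable {cs : CoxeterSystem M W} {θ : W ≃* W} {u v : W} {i : B}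

/-- The expected value of the Möbius function of `Br(ι(θ))`, extended by zero. -/
noncomputable def mobiusValue (cs : CoxeterSystem M W) (θ : W ≃* W) (u v : W) : ℤ :=
  if bruhatLE cs u v ∧ IsFull cs θ u v then (-1) ^ (cs.length u / 2 + cs.length v / 2) else 0

lemma mobiusValue_eq_zero_of_not_le (huv : ¬ bruhatLE cs u v) : mobiusValue cs θ u v = 0 :=
  if_neg fun h => huv h.1

lemma mobiusValue_eq_zero (h : IsTwist cs θ) (hu : u ∈ twistedIdentities θ)
    (hv : v ∈ twistedIdentities θ) (hdv : cs.IsRightDescent v i) (hdu : ¬ cs.IsRightDescent u i)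
    (hact : twistAct cs θ u i ∉ twistedIdentities θ) : mobiusValue cs θ u v = 0 := by
  have huI := twistedIdentities_subset h hu
  have hvI := twistedIdentities_subset h hv
  refine if_neg fun ⟨huv, hf⟩ => hact (hf _ (twistAct_mem h huI i) (bruhatLE_twistAct h huI hdu)
    (twistAct_bruhatLE_of_le h huI hvI huv hdu hdv))

lemma mobiusValue_twistAct_right (h : IsTwist cs θ) (hN : NOF cs θ)
    (hu : u ∈ twistedIdentities θ) (hv : v ∈ twistedIdentities θ)
    (hdv : cs.IsRightDescent v i) (hdu : ¬ cs.IsRightDescent u i)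
    (hact : twistAct cs θ u i ∈ twistedIdentities θ) :
    mobiusValue cs θ u v = - mobiusValue cs θ u (twistAct cs θ v i) := by
  have huI := twistedIdentities_subset h hu
  have hvI := twistedIdentities_subset h hv
  have hle := twistAct_bruhatLE h hvI hdv
  have hlen := length_twistAct_add_two h hv hdv
  have hiff : (bruhatLE cs u v ∧ IsFull cs θ u v) ↔
      (bruhatLE cs u (twistAct cs θ v i) ∧ IsFull cs θ u (twistAct cs θ v i)) := by
    refine ⟨fun ⟨huv, hf⟩ => ⟨bruhatLE_twistAct_of_le h huI hvI huv hdu hdv,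
      fun y hy h1 h2 => hf y hy h1 (h2.trans hle)⟩, fun ⟨huv, hf⟩ => ⟨huv.trans hle, ?_⟩⟩
    intro y hy h1 h2
    by_contra hy'
    obtain ⟨w, hw, hw', huw, hwy, hQ⟩ := exists_separating h hN hy hy' hu h1
    have hdw : ¬ cs.IsRightDescent w i := by
      intro hdw
      have h3 := (hQ _ hact (twistAct_bruhatLE_of_le h huI hw huw hdu hdw)).length_le
      have h4 := length_twistAct_lt h (twistAct_mem h huI i)
        ((isRightDescent_twistAct_iff h huI).mpr hdu)
      rw [twistAct_twistAct] at h4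
      omega
    exact hw' (hf w hw huw (bruhatLE_twistAct_of_le h hw hvI (hwy.trans h2) hdw hdv))
  unfold mobiusValue
  rw [← hlen, show (cs.length (twistAct cs θ v i) + 2) / 2 =
    cs.length (twistAct cs θ v i) / 2 + 1 by omega, ← add_assoc, pow_succ]
  simp only [hiff]
  split_ifs <;> simp

lemma mobiusValue_twistAct_twistAct (h : IsTwist cs θ) (hN : NOF cs θ)
    (hu : u ∈ twistedIdentities θ) (hv : v ∈ twistedIdentities θ)
    (hdv : cs.IsRightDescent v i) (hdu : cs.IsRightDescent u i) :
    mobiusValue cs θ u v = mobiusValue cs θ (twistAct cs θ u i) (twistAct cs θ v i) := by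
  have huI := twistedIdentities_subset h hu
  have hvI := twistedIdentities_subset h hv
  have huI' := twistAct_mem h huI i
  have hvI' := twistAct_mem h hvI i
  have hlev := twistAct_bruhatLE h hvI hdv
  have hleu := twistAct_bruhatLE h huI hdu
  have hdu' : ¬ cs.IsRightDescent (twistAct cs θ u i) i := by
    rw [isRightDescent_twistAct_iff h huI]; exact not_not.mpr hdu
  have hdv' : ¬ cs.IsRightDescent (twistAct cs θ v i) i := by
    rw [isRightDescent_twistAct_iff h hvI]; exact not_not.mpr hdv
  have hlenu := length_twistAct_add_two h hu hdu
  have hlenv := length_twistAct_add_two h hv hdv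
  have hiff : (bruhatLE cs u v ∧ IsFull cs θ u v) ↔
      (bruhatLE cs (twistAct cs θ u i) (twistAct cs θ v i) ∧
        IsFull cs θ (twistAct cs θ u i) (twistAct cs θ v i)) := by
    constructor
    · rintro ⟨huv, hf⟩
      refine ⟨twistAct_bruhatLE_twistAct h huI hvI huv (iff_of_true hdu hdv), ?_⟩
      intro y hy h1 h2
      by_cases hdy : cs.IsRightDescent y i
      · have h3 := twistAct_bruhatLE_of_le h huI' hy h1 hdu' hdy
        rw [twistAct_twistAct] at h3
        exact hf y hy h3 (h2.trans hlev)
      · by_contra hy'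
        have h3 := twistAct_bruhatLE_twistAct h huI' hy h1 (iff_of_false hdu' hdy)
        have h4 := twistAct_bruhatLE_twistAct h hy hvI' h2 (iff_of_false hdy hdv')
        rw [twistAct_twistAct] at h3 h4
        exact twistAct_notMem_of_isRightDescent h hy hy' hdy
          (hf _ (twistAct_mem h hy i) h3 h4)
    · rintro ⟨huv, hf⟩
      have huv' := twistAct_bruhatLE_twistAct h huI' hvI' huv (iff_of_false hdu' hdv')
      rw [twistAct_twistAct, twistAct_twistAct] at huv'
      refine ⟨huv', ?_⟩
      intro y hy h1 h2
      by_contra hy'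
      obtain ⟨w, hw, hw', huw, hwy, hQ⟩ := exists_separating h hN hy hy' hu h1
      have hwv := hwy.trans h2
      by_cases hdw : cs.IsRightDescent w i
      · have hz := hf _ (twistAct_mem h hw i)
          (twistAct_bruhatLE_twistAct h huI hw huw (iff_of_true hdu hdw))
          (twistAct_bruhatLE_twistAct h hw hvI hwv (iff_of_true hdw hdv))
        obtain ⟨h3, h4, h5⟩ := twistAct_of_mem_of_notMem h hw hw' hdw hz
        have h6 := hQ _ hz (twistAct_bruhatLE h hw hdw)
        have h7 := bruhatLE_of_bruhatLE_mul_simple h hN hz h3 h4 u hu (h5 ▸ huw)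
        rw [h6.antisymm h7] at h3
        exact h3 hdu
      · exact hw' (hf w hw (hleu.trans huw) (bruhatLE_twistAct_of_le h hw hvI hwv hdw hdv))
  unfold mobiusValue
  rw [← hlenu, ← hlenv, Nat.add_div_right _ two_pos, Nat.add_div_right _ two_pos]
  simp only [hiff]
  split_ifs
  · ring
  · rfl

lemma finite_twistedIdentities_bruhatLE (cs : CoxeterSystem M W) (θ : W ≃* W) (v : W) :
    {u | u ∈ twistedIdentities θ ∧ bruhatLE cs u v}.Finite :=
  (finite_setOf_bruhatLE cs v).subset fun _ hu => hu.2

/-- The twisted identities below `v`. -/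
noncomputable def lowerIdentities (cs : CoxeterSystem M W) (θ : W ≃* W) (v : W) : Finset W :=
  (finite_twistedIdentities_bruhatLE cs θ v).toFinset

@[simp] lemma mem_lowerIdentities :
    u ∈ lowerIdentities cs θ v ↔ u ∈ twistedIdentities θ ∧ bruhatLE cs u v := by
  simp [lowerIdentities]

lemma mobiusValue_one (θ : W ≃* W) : mobiusValue cs θ 1 1 = 1 := by
  rw [mobiusValue, if_pos]
  · simp
  · refine ⟨.refl cs 1, fun w _ h1 h2 => ?_⟩
    rw [h2.antisymm h1]
    exact one_mem_twistedIdentities θ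

lemma bruhatLE_twistAct_iff_of_not_isRightDescent (h : IsTwist cs θ) {y : W}
    (hy : y ∈ twistedInvolutions θ) (hu : u ∈ twistedInvolutions θ)
    (hdy : ¬ cs.IsRightDescent y i) (hdu : ¬ cs.IsRightDescent u i) :
    bruhatLE cs y (twistAct cs θ u i) ↔ bruhatLE cs y u := by
  refine ⟨fun h1 => ?_, fun h1 => h1.trans (bruhatLE_twistAct h hu hdu)⟩
  have h2 := bruhatLE_twistAct_of_le h hy (twistAct_mem h hu i) h1 hdy
    ((isRightDescent_twistAct_iff h hu).mpr hdu)
  rwa [twistAct_twistAct] at h2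

lemma bruhatLE_twistAct_iff_of_isRightDescent (h : IsTwist cs θ) {y : W}
    (hy : y ∈ twistedInvolutions θ) (hu : u ∈ twistedInvolutions θ)
    (hdy : cs.IsRightDescent y i) (hdu : ¬ cs.IsRightDescent u i) :
    bruhatLE cs y (twistAct cs θ u i) ↔ bruhatLE cs (twistAct cs θ y i) u := by
  have hdu' := (isRightDescent_twistAct_iff h hu).mpr hdu
  have hdy' : ¬ cs.IsRightDescent (twistAct cs θ y i) i := by
    rw [isRightDescent_twistAct_iff h hy]; exact not_not.mpr hdy
  constructor
  · intro h1
    have h2 := twistAct_bruhatLE_twistAct h hy (twistAct_mem h hu i) h1 (iff_of_true hdy hdu')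
    rwa [twistAct_twistAct] at h2
  · intro h1
    have h2 := twistAct_bruhatLE_twistAct h (twistAct_mem h hy i) hu h1 (iff_of_false hdy' hdu)
    rwa [twistAct_twistAct] at h2

lemma twistAct_bruhatLE_iff (h : IsTwist cs θ) (hN : NOF cs θ) {y : W}
    (hy : y ∈ twistedIdentities θ) (hu : u ∈ twistedIdentities θ)
    (hdy : cs.IsRightDescent y i)
    (hu' : ¬ (¬ cs.IsRightDescent u i ∧ twistAct cs θ u i ∈ twistedIdentities θ)) :
    bruhatLE cs (twistAct cs θ y i) u ↔ bruhatLE cs y u := by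
  have hyI := twistedIdentities_subset h hy
  have huI := twistedIdentities_subset h hu
  refine ⟨fun h1 => ?_, fun h1 => (twistAct_bruhatLE h hyI hdy).trans h1⟩
  by_cases hdu : cs.IsRightDescent u i
  · have h2 := twistAct_bruhatLE_of_le h (i := i) (twistAct_mem h hyI i) huI h1
      (by rw [isRightDescent_twistAct_iff h hyI]; exact not_not.mpr hdy) hdu
    rwa [twistAct_twistAct] at h2
  · have hact : twistAct cs θ u i ∉ twistedIdentities θ := fun h2 => hu' ⟨hdu, h2⟩
    have hconj : θ (cs.simple i) * u * cs.simple i = u := by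
      by_contra h2
      exact hact ((twistAct_mem_iff_of_ne h2).mpr hu)
    rw [← bruhatLE_twistAct_iff_of_isRightDescent h hyI huI hdy hdu, twistAct_of_eq hconj] at h1
    exact bruhatLE_of_bruhatLE_mul_simple h hN hu hdu hconj y hy h1

lemma sum_mobiusValue_step (h : IsTwist cs θ) (hN : NOF cs θ) (hv : v ∈ twistedIdentities θ)
    (hdv : cs.IsRightDescent v i) (y : W) :
    ∑ u ∈ lowerIdentities cs θ v, mobiusValue cs θ u v * (if bruhatLE cs y u then 1 else 0) =
      ∑ u ∈ lowerIdentities cs θ v with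
          (¬ cs.IsRightDescent u i ∧ twistAct cs θ u i ∈ twistedIdentities θ),
        mobiusValue cs θ u (twistAct cs θ v i) *
          ((if bruhatLE cs y (twistAct cs θ u i) then 1 else 0) -
            if bruhatLE cs y u then 1 else 0) := by
  have hvI := twistedIdentities_subset h hv
  rw [← Finset.sum_filter_add_sum_filter_not _ (fun u => cs.IsRightDescent u i)]
  have e1 : ∑ u ∈ lowerIdentities cs θ v with cs.IsRightDescent u i,
        mobiusValue cs θ u v * (if bruhatLE cs y u then 1 else 0) =
      ∑ u ∈ lowerIdentities cs θ v with
          (¬ cs.IsRightDescent u i ∧ twistAct cs θ u i ∈ twistedIdentities θ),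
        mobiusValue cs θ u (twistAct cs θ v i) *
          (if bruhatLE cs y (twistAct cs θ u i) then 1 else 0) := by
    refine Finset.sum_bij' (fun u _ => twistAct cs θ u i) (fun u _ => twistAct cs θ u i)
      ?_ ?_ ?_ ?_ ?_
    · intro u hu
      simp only [Finset.mem_filter, mem_lowerIdentities] at hu ⊢
      obtain ⟨⟨hu, huv⟩, hdu⟩ := hu
      have huI := twistedIdentities_subset h hu
      rw [twistAct_twistAct, isRightDescent_twistAct_iff h huI]
      exact ⟨⟨twistAct_mem_of_isRightDescent h hu hdu, (twistAct_bruhatLE h huI hdu).trans huv⟩,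
        not_not.mpr hdu, hu⟩
    · intro u hu
      simp only [Finset.mem_filter, mem_lowerIdentities] at hu ⊢
      obtain ⟨⟨hu, huv⟩, hdu, hact⟩ := hu
      have huI := twistedIdentities_subset h hu
      rw [isRightDescent_twistAct_iff h huI]
      exact ⟨⟨hact, twistAct_bruhatLE_of_le h huI hvI huv hdu hdv⟩, hdu⟩
    · intro u _
      exact twistAct_twistAct cs θ u i
    · intro u _
      exact twistAct_twistAct cs θ u i
    · intro u hu
      simp only [Finset.mem_filter, mem_lowerIdentities] at hu
      rw [twistAct_twistAct, mobiusValue_twistAct_twistAct h hN hu.1.1 hv hdv hu.2]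
  have e2 : ∑ u ∈ lowerIdentities cs θ v with ¬ cs.IsRightDescent u i,
        mobiusValue cs θ u v * (if bruhatLE cs y u then 1 else 0) =
      ∑ u ∈ lowerIdentities cs θ v with
          (¬ cs.IsRightDescent u i ∧ twistAct cs θ u i ∈ twistedIdentities θ),
        mobiusValue cs θ u v * (if bruhatLE cs y u then 1 else 0) := by
    symm
    refine Finset.sum_subset (fun u hu => ?_) (fun u hu hu' => ?_)
    · simp only [Finset.mem_filter] at hu ⊢
      exact ⟨hu.1, hu.2.1⟩
    · simp only [Finset.mem_filter, not_and, mem_lowerIdentities] at hu hu'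
      rw [mobiusValue_eq_zero h hu.1.1 hv hdv hu.2 (hu' hu.1 hu.2), zero_mul]
  rw [e1, e2, ← Finset.sum_add_distrib]
  refine Finset.sum_congr rfl fun u hu => ?_
  simp only [Finset.mem_filter, mem_lowerIdentities] at hu
  rw [mobiusValue_twistAct_right h hN hu.1.1 hv hdv hu.2.1 hu.2.2]
  ring

lemma sum_mobiusValue (h : IsTwist cs θ) (hN : NOF cs θ) (hv : v ∈ twistedIdentities θ) {y : W}
    (hy : y ∈ twistedIdentities θ) :
    ∑ u ∈ lowerIdentities cs θ v, mobiusValue cs θ u v * (if bruhatLE cs y u then 1 else 0) =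
      if y = v then 1 else 0 := by
  induction hn : cs.length v using Nat.strong_induction_on generalizing v y with
  | _ n ih =>
  subst hn
  have hvI := twistedIdentities_subset h hv
  have hyI := twistedIdentities_subset h hy
  by_cases hv1 : v = 1
  · subst hv1
    rw [Finset.sum_eq_single 1]
    · have : bruhatLE cs y 1 ↔ y = 1 :=
        ⟨fun h1 => h1.antisymm (bruhatLE_one_left cs y), fun h1 => h1 ▸ .refl cs y⟩
      simp only [mobiusValue_one, one_mul, this]
    · intro u hu hne
      simp only [mem_lowerIdentities] at hu
      exact absurd (hu.2.antisymm (bruhatLE_one_left cs u)) hne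
    · intro h1
      exact absurd (mem_lowerIdentities.mpr ⟨hv, .refl cs 1⟩) h1
  obtain ⟨i, hdv⟩ := cs.exists_rightDescent_of_ne_one hv1
  rw [sum_mobiusValue_step h hN hv hdv]
  by_cases hdy : cs.IsRightDescent y i
  · have hv' := twistAct_mem_of_isRightDescent h hv hdv
    have hlev := twistAct_bruhatLE h hvI hdv
    have key : ∀ {x : W}, x ∈ twistedIdentities θ →
        ∑ u ∈ lowerIdentities cs θ v, mobiusValue cs θ u (twistAct cs θ v i) *
          (if bruhatLE cs x u then 1 else 0) = if x = twistAct cs θ v i then 1 else 0 := by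
      intro x hx
      rw [← ih _ (length_twistAct_lt h hvI hdv) hv' hx rfl]
      symm
      refine Finset.sum_subset (fun u hu => ?_) (fun u hu hu' => ?_)
      · simp only [mem_lowerIdentities] at hu ⊢
        exact ⟨hu.1, hu.2.trans hlev⟩
      · simp only [mem_lowerIdentities, not_and] at hu hu'
        rw [mobiusValue_eq_zero_of_not_le (hu' hu.1), zero_mul]
    have e : ∑ u ∈ lowerIdentities cs θ v with
          (¬ cs.IsRightDescent u i ∧ twistAct cs θ u i ∈ twistedIdentities θ),
        mobiusValue cs θ u (twistAct cs θ v i) *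
          ((if bruhatLE cs y (twistAct cs θ u i) then 1 else 0) -
            if bruhatLE cs y u then 1 else 0) =
        ∑ u ∈ lowerIdentities cs θ v, mobiusValue cs θ u (twistAct cs θ v i) *
          ((if bruhatLE cs (twistAct cs θ y i) u then 1 else 0) -
            if bruhatLE cs y u then 1 else 0) := by
      rw [Finset.sum_filter]
      refine Finset.sum_congr rfl fun u hu => ?_
      simp only [mem_lowerIdentities] at hu
      by_cases hc : ¬ cs.IsRightDescent u i ∧ twistAct cs θ u i ∈ twistedIdentities θ
      · rw [if_pos hc]
        simp only [bruhatLE_twistAct_iff_of_isRightDescent h hyI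
          (twistedIdentities_subset h hu.1) hdy hc.1]
      · rw [if_neg hc]
        simp only [twistAct_bruhatLE_iff h hN hy hu.1 hdy hc, sub_self, mul_zero]
    rw [e]
    simp only [mul_sub, Finset.sum_sub_distrib]
    rw [key (twistAct_mem_of_isRightDescent h hy hdy), key hy]
    have h1 : y ≠ twistAct cs θ v i := by
      rintro rfl
      rw [isRightDescent_twistAct_iff h hvI] at hdy
      exact hdy hdv
    have h2 : twistAct cs θ y i = twistAct cs θ v i ↔ y = v := by
      refine ⟨fun h3 => ?_, fun h3 => h3 ▸ rfl⟩
      rw [← twistAct_twistAct cs θ y i, h3, twistAct_twistAct]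
    rw [if_neg h1, sub_zero]
    simp only [h2]
  · rw [if_neg (by rintro rfl; exact hdy hdv)]
    refine Finset.sum_eq_zero fun u hu => ?_
    simp only [Finset.mem_filter, mem_lowerIdentities] at hu
    simp only [bruhatLE_twistAct_iff_of_not_isRightDescent h hyI
      (twistedIdentities_subset h hu.1.1) hdy hu.2.1, sub_self, mul_zero]

lemma twistProd_append_singleton (cs : CoxeterSystem M W) (θ : W ≃* W) (l : List B) (i : B) :
    twistProd cs θ (l ++ [i]) = twistAct cs θ (twistProd cs θ l) i := by
  simp [twistProd]

lemma length_twistProd_le (h : IsTwist cs θ) (l : List B) :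
    twistProd cs θ l ∈ twistedInvolutions θ ∧
      cs.length (twistProd cs θ l) ≤ 2 * l.length := by
  induction l using List.reverseRecOn with
  | nil => simp [twistProd, twistedInvolutions]
  | append_singleton l i ih =>
    obtain ⟨h1, h2⟩ := ih
    rw [twistProd_append_singleton]
    refine ⟨twistAct_mem h h1 i, ?_⟩
    rw [List.length_append, List.length_singleton]
    by_cases hd : cs.IsRightDescent (twistProd cs θ l) i
    · have := length_twistAct_lt h h1 hd
      omega
    · by_cases h3 : θ (cs.simple i) * twistProd cs θ l * cs.simple i = twistProd cs θ l
      · have := (length_twistAct_of_eq h3).2 hd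
        omega
      · have := (length_twistAct_of_ne h h1 h3).2 hd
        omega

lemma exists_twistProd (h : IsTwist cs θ) (hv : v ∈ twistedIdentities θ) :
    ∃ l : List B, 2 * l.length = cs.length v ∧ twistProd cs θ l = v := by
  induction hn : cs.length v using Nat.strong_induction_on generalizing v with
  | _ n ih =>
  subst hn
  by_cases hv1 : v = 1
  · subst hv1
    exact ⟨[], by simp [twistProd]⟩
  obtain ⟨i, hdv⟩ := cs.exists_rightDescent_of_ne_one hv1
  have hlen := length_twistAct_add_two h hv hdv
  obtain ⟨l, h1, h2⟩ := ih _ (by omega) (twistAct_mem_of_isRightDescent h hv hdv) rfl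
  refine ⟨l ++ [i], ?_, ?_⟩
  · rw [List.length_append, List.length_singleton]
    omega
  · rw [twistProd_append_singleton, h2, twistAct_twistAct]

lemma two_mul_twistRank (h : IsTwist cs θ) (hv : v ∈ twistedIdentities θ) :
    2 * twistRank cs θ v = cs.length v := by
  obtain ⟨l, h1, h2⟩ := exists_twistProd h hv
  have h3 : twistRank cs θ v ≤ l.length := Nat.sInf_le ⟨l, rfl, h2⟩
  obtain ⟨l', h4, h5⟩ : ∃ l' : List B, l'.length = twistRank cs θ v ∧ twistProd cs θ l' = v :=
    Nat.sInf_mem (s := {k | ∃ l : List B, l.length = k ∧ twistProd cs θ l = v}) ⟨_, l, rfl, h2⟩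
  have h6 := (length_twistProd_le h l').2
  rw [h5] at h6
  omega

lemma mobiusValue_eq (h : IsTwist cs θ) (hu : u ∈ twistedIdentities θ)
    (hv : v ∈ twistedIdentities θ) (huv : bruhatLE cs u v) :
    mobiusValue cs θ u v =
      if IsFull cs θ u v then (-1 : ℤ) ^ (twistRank cs θ v - twistRank cs θ u) else 0 := by
  have h1 := two_mul_twistRank h hu
  have h2 := two_mul_twistRank h hv
  have h3 := huv.length_le
  simp only [mobiusValue, huv, true_and]
  split_ifs
  · rw [show cs.length u / 2 + cs.length v / 2 =
      2 * twistRank cs θ u + (twistRank cs θ v - twistRank cs θ u) by omega, pow_add, pow_mul]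
    simp
  · rfl

/-- Defining recursion of the Möbius function, summed over a large enough finite set. -/
lemma sum_mobius_eq {mu : W → W → ℤ} (hmurefl : ∀ u ∈ twistedIdentities θ, mu u u = 1)
    (hmurec : ∀ u ∈ twistedIdentities θ, ∀ v ∈ twistedIdentities θ, bruhatLT cs u v →
      mu u v = - ∑ᶠ x ∈ {x | x ∈ twistedIdentities θ ∧ bruhatLE cs u x ∧ bruhatLT cs x v},
        mu u x) {w : W} (hu : u ∈ twistedIdentities θ) (hw : w ∈ lowerIdentities cs θ v) :
    ∑ x ∈ lowerIdentities cs θ v with (bruhatLE cs u x ∧ bruhatLE cs x w), mu u x =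
      if u = w then 1 else 0 := by
  rw [mem_lowerIdentities] at hw
  obtain ⟨hw, hwv⟩ := hw
  by_cases huw : bruhatLE cs u w
  · by_cases hne : u = w
    · subst hne
      rw [if_pos rfl, ← hmurefl u hu]
      refine Finset.sum_eq_single_of_mem u ?_ fun x hx hxu => ?_
      · simp only [Finset.mem_filter, mem_lowerIdentities]
        exact ⟨⟨hu, hwv⟩, .refl cs u, .refl cs u⟩
      · simp only [Finset.mem_filter] at hx
        exact absurd (hx.2.2.antisymm hx.2.1) hxu
    · have hmem : w ∈ (lowerIdentities cs θ v).filter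
          (fun x => bruhatLE cs u x ∧ bruhatLE cs x w) := by
        simp only [Finset.mem_filter, mem_lowerIdentities]
        exact ⟨⟨hw, hwv⟩, huw, .refl cs w⟩
      have hset : {x | x ∈ twistedIdentities θ ∧ bruhatLE cs u x ∧ bruhatLT cs x w} =
          ↑(((lowerIdentities cs θ v).filter
            (fun x => bruhatLE cs u x ∧ bruhatLE cs x w)).erase w) := by
        ext x
        simp only [Set.mem_ofPred_eq, Finset.coe_erase, Finset.coe_filter, Set.mem_sdiff,
          Set.mem_singleton_iff, mem_lowerIdentities, bruhatLT]
        constructor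
        · rintro ⟨h1, h2, h3, h4⟩
          exact ⟨⟨⟨h1, h3.trans hwv⟩, h2, h3⟩, h4⟩
        · rintro ⟨⟨⟨h1, -⟩, h2, h3⟩, h4⟩
          exact ⟨h1, h2, h3, h4⟩
      rw [← Finset.add_sum_erase _ _ hmem, hmurec u hu w hw ⟨huw, hne⟩, hset,
        finsum_mem_coe_finset, neg_add_cancel, if_neg hne]
  · rw [if_neg (by rintro rfl; exact huw (.refl cs u))]
    refine Finset.sum_eq_zero fun x hx => ?_
    simp only [Finset.mem_filter] at hx
    exact absurd (hx.2.1.trans hx.2.2) huw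

end Mobius

theorem statement15 [Finite B] (cs : CoxeterSystem M W) (θ : W ≃* W)
    (hθ : Function.Involutive θ)
    (hθS : ∀ i : B, ∃ j : B, θ (cs.simple i) = cs.simple j)
    (hNOF : NOF cs θ)
    (mu : W → W → ℤ)
    (hmurefl : ∀ u ∈ twistedIdentities θ, mu u u = 1)
    (hmurec : ∀ u ∈ twistedIdentities θ, ∀ v ∈ twistedIdentities θ, bruhatLT cs u v →
      mu u v = - ∑ᶠ x ∈ {x | x ∈ twistedIdentities θ ∧ bruhatLE cs u x ∧ bruhatLT cs x v},
        mu u x)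
    (u v : W) (hu : u ∈ twistedIdentities θ) (hv : v ∈ twistedIdentities θ)
    (huv : bruhatLE cs u v) :
    mu u v =
      if IsFull cs θ u v then (-1 : ℤ) ^ (twistRank cs θ v - twistRank cs θ u)
      else 0 := by
  have h : IsTwist cs θ := ⟨hθ, hθS⟩
  rw [← mobiusValue_eq h hu hv huv]
  have hvS : v ∈ lowerIdentities cs θ v := mem_lowerIdentities.mpr ⟨hv, .refl cs v⟩
  have huS : u ∈ lowerIdentities cs θ v := mem_lowerIdentities.mpr ⟨hu, huv⟩
  calc mu u v
      = ∑ x ∈ lowerIdentities cs θ v, (if bruhatLE cs u x then mu u x else 0) *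
          (if x = v then 1 else 0) := by
        simp [hvS, huv]
    _ = ∑ x ∈ lowerIdentities cs θ v, (if bruhatLE cs u x then mu u x else 0) *
          ∑ w ∈ lowerIdentities cs θ v,
            mobiusValue cs θ w v * (if bruhatLE cs x w then 1 else 0) := by
        refine Finset.sum_congr rfl fun x hx => ?_
        rw [sum_mobiusValue h hNOF hv (mem_lowerIdentities.mp hx).1]
    _ = ∑ w ∈ lowerIdentities cs θ v, mobiusValue cs θ w v *
          ∑ x ∈ lowerIdentities cs θ v with (bruhatLE cs u x ∧ bruhatLE cs x w), mu u x := by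
        simp only [Finset.mul_sum, Finset.sum_filter]
        rw [Finset.sum_comm]
        refine Finset.sum_congr rfl fun w _ => Finset.sum_congr rfl fun x _ => ?_
        by_cases h1 : bruhatLE cs u x <;> by_cases h2 : bruhatLE cs x w <;> simp [h1, h2, mul_comm]
    _ = ∑ w ∈ lowerIdentities cs θ v, mobiusValue cs θ w v * (if u = w then 1 else 0) := by
        refine Finset.sum_congr rfl fun w hw => ?_
        rw [sum_mobius_eq hmurefl hmurec hu hw]
    _ = mobiusValue cs θ u v := by
        simp [huS]

end TwistedIdentitiesPaper
end

section
/- If Poin(W;t) = Poin(ι(θ);t)·Poin(Fix(θ);t) as formal power series, then for every s ∈ S the order m(s,θ(s)) of sθ(s) lies in {1,2,∞} (where m(s,θ(s)) = 1 means θ(s) = s). -/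
namespace TwistedIdentitiesPaper

open scoped Classical

variable {B : Type*} {W : Type*} [Group W] {M : CoxeterMatrix B}

/-- The Poincaré series of `W`: the generating function of the Coxeter length. -/
noncomputable def poinW (cs : CoxeterSystem M W) : PowerSeries ℕ :=
  PowerSeries.mk fun n => Nat.card {w : W // cs.length w = n}

/-- The Poincaré series of `ι(θ)`: the generating function of the rank `ρ`. -/
noncomputable def poinIota (cs : CoxeterSystem M W) (θ : W ≃* W) : PowerSeries ℕ :=
  PowerSeries.mk fun n =>
    Nat.card {w : W // w ∈ twistedIdentities θ ∧ twistRank cs θ w = n}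

/-- The canonical Coxeter generators of `Fix(θ)`: the longest elements of the finite
standard parabolic subgroups `W_J` with `J = {s, θ(s)}`, `s ∈ S`. -/
def canonicalGens (cs : CoxeterSystem M W) (θ : W ≃* W) : Set W :=
  {x | ∃ i : B,
    (Subgroup.closure ({cs.simple i, θ (cs.simple i)} : Set W) : Set W).Finite ∧
    x ∈ Subgroup.closure ({cs.simple i, θ (cs.simple i)} : Set W) ∧
    ∀ y ∈ Subgroup.closure ({cs.simple i, θ (cs.simple i)} : Set W),
      cs.length y ≤ cs.length x}

/-- The word length on `Fix(θ)` with respect to its canonical Coxeter generators. -/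
noncomputable def fixLength (cs : CoxeterSystem M W) (θ : W ≃* W) (f : W) : ℕ :=
  sInf {n | ∃ l : List W, l.length = n ∧ (∀ x ∈ l, x ∈ canonicalGens cs θ) ∧ l.prod = f}

/-- The Poincaré series of `Fix(θ)`. -/
noncomputable def poinFix (cs : CoxeterSystem M W) (θ : W ≃* W) : PowerSeries ℕ :=
  PowerSeries.mk fun n => Nat.card {w : W // θ w = w ∧ fixLength cs θ w = n}

section Exchange

theorem end_one_apply {α : Type*} (a : α) : (1 : Function.End α) a = a := rfl

theorem end_mul_apply {α : Type*} (f g : Function.End α) (a : α) : (f * g) a = f (g a) := rfl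

variable (cs : CoxeterSystem M W)

/-- The generator `sᵢ` acting on `W × ℤ/2` by `(t, ε) ↦ (sᵢ t sᵢ, ε + [t = sᵢ])`. -/
noncomputable def signedConj (i : B) : Function.End (W × ZMod 2) :=
  fun p => (cs.simple i * p.1 * cs.simple i, p.2 + if p.1 = cs.simple i then 1 else 0)

theorem signedConj_mul_pow (i j : B) (n : ℕ) (t : W) (ε : ZMod 2) :
    ((signedConj cs i * signedConj cs j) ^ n) (t, ε) =
      ((cs.simple i * cs.simple j) ^ n * t * ((cs.simple i * cs.simple j) ^ n)⁻¹,
        ε + ∑ k ∈ Finset.range (2 * n),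
          if t = cs.simple j * (cs.simple i * cs.simple j) ^ k then 1 else 0) := by
  induction n with
  | zero => simp [end_one_apply]
  | succ n ih =>
    have inv_mul (k : ℕ) : ((cs.simple i * cs.simple j) ^ k)⁻¹ * cs.simple j =
        cs.simple j * (cs.simple i * cs.simple j) ^ k := by
      induction k with
      | zero => simp
      | succ k ih =>
        rw [pow_succ, mul_inv_rev, mul_assoc, ih]
        rw [← pow_succ, pow_succ']
        simp [mul_assoc]
    have h₁ : (cs.simple i * cs.simple j) ^ n * t * ((cs.simple i * cs.simple j) ^ n)⁻¹ =
        cs.simple j ↔ t = cs.simple j * (cs.simple i * cs.simple j) ^ (2 * n) := by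
      rw [two_mul, pow_add, ← mul_assoc, ← inv_mul, mul_inv_eq_iff_eq_mul, mul_assoc,
        eq_inv_mul_iff_mul_eq]
    have h₂ : cs.simple j * ((cs.simple i * cs.simple j) ^ n * t *
        ((cs.simple i * cs.simple j) ^ n)⁻¹) * cs.simple j = cs.simple i ↔
        t = cs.simple j * (cs.simple i * cs.simple j) ^ (2 * n + 1) := by
      have e : cs.simple j * (cs.simple i * cs.simple j) ^ (2 * n + 1) =
          ((cs.simple i * cs.simple j) ^ n)⁻¹ * (cs.simple j * cs.simple i * cs.simple j) *
            (cs.simple i * cs.simple j) ^ n := by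
        rw [show 2 * n + 1 = n + 1 + n by ring, pow_add, pow_succ, ← mul_assoc, ← mul_assoc,
          ← inv_mul]
        simp only [mul_assoc]
      rw [e]
      generalize (cs.simple i * cs.simple j) ^ n = r
      constructor
      · intro h
        rw [← h]
        simp [mul_assoc]
      · rintro rfl
        simp [mul_assoc]
    rw [pow_succ', end_mul_apply, ih, end_mul_apply]
    simp only [signedConj, h₁, h₂, show 2 * (n + 1) = 2 * n + 1 + 1 by ring,
      Finset.sum_range_succ, Prod.mk.injEq]
    refine ⟨?_, by ring⟩
    rw [pow_succ']
    simp [mul_assoc]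

theorem isLiftable_signedConj : M.IsLiftable (signedConj cs) := by
  intro i j
  funext ⟨t, ε⟩
  rw [signedConj_mul_pow, cs.simple_mul_simple_pow, two_mul, Finset.sum_range_add]
  simp only [pow_add, cs.simple_mul_simple_pow, one_mul, CharTwo.add_self_eq_zero]
  simp [end_one_apply]

theorem lift_signedConj_wordProd (ω : List B) (t : W) (ε : ZMod 2) :
    cs.lift ⟨signedConj cs, isLiftable_signedConj cs⟩ (cs.wordProd ω) (t, ε) =
      (cs.wordProd ω * t * (cs.wordProd ω)⁻¹, ε + (cs.rightInvSeq ω).count t) := by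
  induction ω with
  | nil => simp [end_one_apply]
  | cons i ω ih =>
    rw [cs.wordProd_cons, map_mul, end_mul_apply, ih,
      cs.lift_apply_simple, signedConj, CoxeterSystem.rightInvSeq, List.count_cons]
    have e : cs.wordProd ω * t * (cs.wordProd ω)⁻¹ = cs.simple i ↔
        (cs.wordProd ω)⁻¹ * cs.simple i * cs.wordProd ω = t := by
      constructor
      · intro h
        rw [← h]
        group
      · rintro rfl
        group
    simp only [mul_assoc] at e
    simp [e, mul_assoc, add_assoc]

/-- The exchange condition, for a word that need not be reduced. -/
theorem exists_eraseIdx_of_isRightDescent (ω : List B) {i : B}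
    (h : cs.IsRightDescent (cs.wordProd ω) i) :
    ∃ p < ω.length, cs.wordProd ω * cs.simple i = cs.wordProd (ω.eraseIdx p) := by
  obtain ⟨ω', hω', e⟩ := cs.exists_isReduced (cs.wordProd ω * cs.simple i)
  have e' : cs.wordProd (ω'.concat i) = cs.wordProd ω := by
    rw [cs.wordProd_concat, ← e]
    simp
  have hr : cs.IsReduced (ω'.concat i) := by
    rw [CoxeterSystem.IsReduced, e', List.length_concat, ← hω'.eq, ← e]
    exact (cs.isRightDescent_iff.mp h).symm
  have hcount : (cs.rightInvSeq (ω'.concat i)).count (cs.simple i) = 1 :=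
    List.count_eq_one_of_mem hr.nodup_rightInvSeq (by rw [cs.rightInvSeq_concat]; simp)
  have h₁ := lift_signedConj_wordProd cs ω (cs.simple i) 0
  rw [← e', lift_signedConj_wordProd, hcount] at h₁
  have h₂ : cs.simple i ∈ cs.rightInvSeq ω := by
    rw [← List.count_pos_iff]
    by_contra h₀
    simp [Nat.eq_zero_of_not_pos h₀] at h₁
  obtain ⟨p, hp, h₃⟩ := List.getElem_of_mem h₂
  refine ⟨p, by simpa using hp, ?_⟩
  rw [← cs.wordProd_mul_getD_rightInvSeq, List.getD_eq_getElem _ _ hp, h₃]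

/-- The deletion condition. -/
theorem exists_isReduced_sublist (ω : List B) :
    ∃ ω' : List B, ω'.Sublist ω ∧ cs.IsReduced ω' ∧ cs.wordProd ω' = cs.wordProd ω := by
  induction ω using List.reverseRecOn with
  | nil => exact ⟨[], by simp [CoxeterSystem.IsReduced]⟩
  | append_singleton ω i ih =>
    obtain ⟨ω', hsub, hred, e⟩ := ih
    have e' : cs.wordProd (ω ++ [i]) = cs.wordProd ω' * cs.simple i := by
      simp [cs.wordProd_append, e]
    by_cases hi : cs.IsRightDescent (cs.wordProd ω') i
    · obtain ⟨p, hp, h⟩ := exists_eraseIdx_of_isRightDescent cs ω' hi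
      refine ⟨ω'.eraseIdx p, (List.eraseIdx_sublist _ _).trans
        (hsub.trans (List.sublist_append_left _ _)), ?_, by rw [e', h]⟩
      have hl := cs.isRightDescent_iff.mp hi
      rw [CoxeterSystem.IsReduced, ← h, List.length_eraseIdx_of_lt hp, ← hred.eq]
      omega
    · refine ⟨ω' ++ [i], hsub.append_right _, ?_, by simp [cs.wordProd_append, e]⟩
      have hl := cs.not_isRightDescent_iff.mp hi
      rw [CoxeterSystem.IsReduced, cs.wordProd_append, List.length_append, ← hred.eq]
      simpa using hl

theorem exists_mem_of_wordProd_eq_simple {ω : List B} {k : B}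
    (h : cs.wordProd ω = cs.simple k) : ∃ i ∈ ω, cs.simple k = cs.simple i := by
  obtain ⟨ω', hsub, hred, e⟩ := exists_isReduced_sublist cs ω
  have hlen : ω'.length = 1 := by rw [← hred.eq, e, h, cs.length_simple]
  obtain ⟨i, rfl⟩ := List.length_eq_one_iff.mp hlen
  exact ⟨i, hsub.subset (by simp), by rw [← h, ← e, cs.wordProd_singleton]⟩

end Exchange

section Dihedral

variable (cs : CoxeterSystem M W)

theorem wordProd_mem_closure_pair {i j : B} {ω : List B} (h : ∀ k ∈ ω, k = i ∨ k = j) :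
    cs.wordProd ω ∈ Subgroup.closure ({cs.simple i, cs.simple j} : Set W) := by
  refine Subgroup.list_prod_mem _ fun x hx => Subgroup.subset_closure ?_
  obtain ⟨k, hk, rfl⟩ := List.mem_map.mp hx
  rcases h k hk with rfl | rfl <;> simp

theorem exists_word_of_mem_closure_pair {i j : B} {x : W}
    (hx : x ∈ Subgroup.closure ({cs.simple i, cs.simple j} : Set W)) :
    ∃ ω : List B, (∀ k ∈ ω, k = i ∨ k = j) ∧ cs.IsReduced ω ∧ cs.wordProd ω = x := by
  suffices ∃ ω : List B, (∀ k ∈ ω, k = i ∨ k = j) ∧ cs.wordProd ω = x by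
    obtain ⟨ω, hω, rfl⟩ := this
    obtain ⟨ω', hsub, hred, e⟩ := exists_isReduced_sublist cs ω
    exact ⟨ω', fun k hk => hω k (hsub.subset hk), hred, e⟩
  induction hx using Subgroup.closure_induction with
  | mem x hx =>
    rcases hx with rfl | rfl
    · exact ⟨[i], by simp⟩
    · exact ⟨[j], by simp⟩
  | one => exact ⟨[], by simp⟩
  | mul x y _ _ hx hy =>
    obtain ⟨ω, hω, rfl⟩ := hx
    obtain ⟨ω', hω', rfl⟩ := hy
    refine ⟨ω ++ ω', fun k hk => ?_, cs.wordProd_append _ _⟩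
    rcases List.mem_append.mp hk with hk | hk
    exacts [hω k hk, hω' k hk]
  | inv x _ hx =>
    obtain ⟨ω, hω, rfl⟩ := hx
    exact ⟨ω.reverse, by simpa using hω, cs.wordProd_reverse _⟩

theorem simple_mem_closure_pair {i j k : B}
    (h : cs.simple k ∈ Subgroup.closure ({cs.simple i, cs.simple j} : Set W)) :
    cs.simple k = cs.simple i ∨ cs.simple k = cs.simple j := by
  obtain ⟨ω, hω, -, e⟩ := exists_word_of_mem_closure_pair cs h
  obtain ⟨l, hl, e'⟩ := exists_mem_of_wordProd_eq_simple cs e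
  rcases hω l hl with rfl | rfl
  exacts [Or.inl e', Or.inr e']

theorem eq_alternatingWord_of_isReduced {i j : B} {ω : List B} (h : ∀ k ∈ ω, k = i ∨ k = j)
    (hred : cs.IsReduced ω) :
    ω = CoxeterSystem.alternatingWord i j ω.length ∨
      ω = CoxeterSystem.alternatingWord j i ω.length := by
  have not_reduced (ω : List B) (k : B) : ¬ cs.IsReduced ((ω.concat k).concat k) := by
    intro h
    have h₁ := h.eq
    rw [cs.wordProd_concat, cs.wordProd_concat, cs.simple_mul_simple_cancel_right,
      List.length_concat, List.length_concat] at h₁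
    have := cs.length_wordProd_le ω
    omega
  induction ω using List.reverseRecOn with
  | nil => simp [CoxeterSystem.alternatingWord]
  | append_singleton ω k ih =>
    have hω : cs.IsReduced ω := by simpa using hred.take ω.length
    specialize ih (fun l hl => h l (by simp [hl])) hω
    rw [List.length_append, List.length_singleton, CoxeterSystem.alternatingWord_succ,
      CoxeterSystem.alternatingWord_succ, ← List.concat_eq_append]
    rw [← List.concat_eq_append] at hred
    rcases hn : ω.length with _ | n
    · obtain rfl := List.eq_nil_of_length_eq_zero hn
      rcases h k (by simp) with rfl | rfl <;> simp [CoxeterSystem.alternatingWord]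
    rw [hn] at ih
    rcases h k (by simp) with rfl | rfl
    · rcases ih with e | e
      · exact Or.inr (by rw [← e])
      · rw [e, CoxeterSystem.alternatingWord_succ] at hred
        exact (not_reduced _ _ hred).elim
    · rcases ih with e | e
      · rw [e, CoxeterSystem.alternatingWord_succ] at hred
        exact (not_reduced _ _ hred).elim
      · exact Or.inl (by rw [← e])

theorem eq_wordProd_alternatingWord {i j : B} {x : W}
    (hx : x ∈ Subgroup.closure ({cs.simple i, cs.simple j} : Set W)) :
    x = cs.wordProd (CoxeterSystem.alternatingWord i j (cs.length x)) ∨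
      x = cs.wordProd (CoxeterSystem.alternatingWord j i (cs.length x)) := by
  obtain ⟨ω, hω, hred, rfl⟩ := exists_word_of_mem_closure_pair cs hx
  rw [hred.eq]
  exact (eq_alternatingWord_of_isReduced cs hω hred).imp (congrArg _) (congrArg _)

theorem finite_closure_pair {i j : B} (h : orderOf (cs.simple i * cs.simple j) ≠ 0) :
    (Subgroup.closure ({cs.simple i, cs.simple j} : Set W) : Set W).Finite := by
  have hfin : (Subgroup.zpowers (cs.simple i * cs.simple j) : Set W).Finite :=
    finite_zpowers.mpr (orderOf_ne_zero_iff.mp h)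
  have hs : ({1, cs.simple i, cs.simple j} : Set W).Finite := Set.toFinite _
  refine (hs.mul hfin).subset fun x hx => ?_
  rcases eq_wordProd_alternatingWord cs hx with e | e <;>
    rw [e, cs.prod_alternatingWord_eq_mul_pow]
  · refine Set.mul_mem_mul (by split_ifs <;> simp) ?_
    exact Subgroup.pow_mem _ (Subgroup.mem_zpowers _) _
  · refine Set.mul_mem_mul (by split_ifs <;> simp) ?_
    refine Subgroup.pow_mem _ ?_ _
    rw [← inv_inv (cs.simple j * cs.simple i), mul_inv_rev, cs.inv_simple, cs.inv_simple]
    exact Subgroup.inv_mem _ (Subgroup.mem_zpowers _)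

/-- A longest element of a dihedral standard parabolic subgroup is represented by both
alternating words. -/
theorem wordProd_alternatingWord_eq_of_longest {i j : B} (hij : cs.simple i ≠ cs.simple j) {x : W}
    (hx : x ∈ Subgroup.closure ({cs.simple i, cs.simple j} : Set W))
    (hmax : ∀ y ∈ Subgroup.closure ({cs.simple i, cs.simple j} : Set W),
      cs.length y ≤ cs.length x)
    (e : x = cs.wordProd (CoxeterSystem.alternatingWord i j (cs.length x))) :
    x = cs.wordProd (CoxeterSystem.alternatingWord j i (cs.length x)) := by
  have hxi := mul_mem hx (Subgroup.subset_closure (Set.mem_insert (cs.simple i) {cs.simple j}))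
  rcases cs.length_mul_simple x i with h | h
  · have := hmax _ hxi
    omega
  rw [← h, CoxeterSystem.alternatingWord_succ, cs.wordProd_concat]
  rw [← h, CoxeterSystem.alternatingWord_succ, cs.wordProd_concat] at e
  rcases eq_wordProd_alternatingWord cs hxi with e' | e'
  · rw [← e', cs.simple_mul_simple_cancel_right]
  · rw [← e', mul_assoc, left_eq_mul] at e
    exact (hij (by simpa using mul_eq_one_iff_eq_inv.mp e)).elim

theorem map_wordProd_alternatingWord (θ : W ≃* W) {i j : B} (hi : θ (cs.simple i) = cs.simple j)
    (hj : θ (cs.simple j) = cs.simple i) (n : ℕ) :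
    θ (cs.wordProd (CoxeterSystem.alternatingWord i j n)) =
      cs.wordProd (CoxeterSystem.alternatingWord j i n) := by
  induction n generalizing i j with
  | zero => simp [CoxeterSystem.alternatingWord]
  | succ n ih =>
    rw [CoxeterSystem.alternatingWord_succ, CoxeterSystem.alternatingWord_succ,
      cs.wordProd_concat, cs.wordProd_concat, map_mul, ih hj hi, hj]

theorem map_eq_self_of_longest (θ : W ≃* W) {i j : B} (hi : θ (cs.simple i) = cs.simple j)
    (hj : θ (cs.simple j) = cs.simple i) {x : W}
    (hx : x ∈ Subgroup.closure ({cs.simple i, cs.simple j} : Set W))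
    (hmax : ∀ y ∈ Subgroup.closure ({cs.simple i, cs.simple j} : Set W),
      cs.length y ≤ cs.length x) : θ x = x := by
  by_cases hij : cs.simple i = cs.simple j
  · have : Set.EqOn θ.toMonoidHom (MonoidHom.id W)
        (Subgroup.closure ({cs.simple i, cs.simple j} : Set W)) := by
      refine MonoidHom.eqOn_closure ?_
      rintro y (rfl | rfl)
      · simp [hi, ← hij]
      · simp [hj, hij]
    exact this hx
  rcases eq_wordProd_alternatingWord cs hx with e | e
  · conv_lhs => rw [e]
    rw [map_wordProd_alternatingWord cs θ hi hj]
    exact (wordProd_alternatingWord_eq_of_longest cs hij hx hmax e).symm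
  · conv_lhs => rw [e]
    rw [map_wordProd_alternatingWord cs θ hj hi]
    rw [Set.pair_comm] at hx hmax
    exact (wordProd_alternatingWord_eq_of_longest cs (Ne.symm hij) hx hmax e).symm

/-- Any simple reflection `sₖ` shortening an element of the parabolic subgroup generated by
`sᵢ, sⱼ` is one of the two. -/
theorem simple_eq_of_isRightDescent {i j k : B} {x : W}
    (hx : x ∈ Subgroup.closure ({cs.simple i, cs.simple j} : Set W))
    (hk : cs.IsRightDescent x k) :
    cs.simple k = cs.simple i ∨ cs.simple k = cs.simple j := by
  apply simple_mem_closure_pair cs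
  obtain ⟨ω, hω, -, rfl⟩ := exists_word_of_mem_closure_pair cs hx
  obtain ⟨p, -, e⟩ := exists_eraseIdx_of_isRightDescent cs ω hk
  rw [eq_inv_mul_of_mul_eq e]
  exact mul_mem (inv_mem hx)
    (wordProd_mem_closure_pair cs fun l hl => hω l (List.mem_of_mem_eraseIdx hl))

end Dihedral

section LinearCoefficient

variable (cs : CoxeterSystem M W) (θ : W ≃* W)

theorem mem_of_sInf_eq {s : Set ℕ} {n : ℕ} (hs : s.Nonempty) (h : sInf s = n) : n ∈ s :=
  h ▸ Nat.sInf_mem hs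

theorem fixLength_eq_one {x : W} (hx : x ∈ canonicalGens cs θ) (h1 : x ≠ 1) :
    fixLength cs θ x = 1 := by
  have hmem : 1 ∈ {n | ∃ l : List W, l.length = n ∧ (∀ y ∈ l, y ∈ canonicalGens cs θ) ∧
      l.prod = x} := ⟨[x], by simpa using hx⟩
  have hle : fixLength cs θ x ≤ 1 := Nat.sInf_le hmem
  have hne : fixLength cs θ x ≠ 0 := by
    intro h0
    obtain ⟨l, hl, -, e⟩ := mem_of_sInf_eq ⟨1, hmem⟩ h0
    rw [List.length_eq_zero_iff.mp hl] at e
    exact h1 e.symm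
  omega

theorem mem_canonicalGens_of_fixLength_eq_one {x : W} (h : fixLength cs θ x = 1) :
    x ∈ canonicalGens cs θ := by
  obtain ⟨l, hl, hmem, e⟩ := mem_of_sInf_eq (Nat.nonempty_of_sInf_eq_succ h) h
  obtain ⟨y, rfl⟩ := List.length_eq_one_iff.mp hl
  rw [List.prod_singleton] at e
  exact e ▸ hmem y (by simp)

theorem finite_canonicalGens [Finite B] : (canonicalGens cs θ).Finite := by
  have : canonicalGens cs θ ⊆ ⋃ i : B, {x |
      (Subgroup.closure ({cs.simple i, θ (cs.simple i)} : Set W) : Set W).Finite ∧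
      x ∈ Subgroup.closure ({cs.simple i, θ (cs.simple i)} : Set W)} := by
    rintro x ⟨i, h₁, h₂, -⟩
    exact Set.mem_iUnion.mpr ⟨i, h₁, h₂⟩
  refine (Set.finite_iUnion fun i => ?_).subset this
  by_cases h : (Subgroup.closure ({cs.simple i, θ (cs.simple i)} : Set W) : Set W).Finite
  · exact h.subset fun x hx => hx.2
  · exact Set.finite_empty.subset fun x hx => (h hx.1).elim

theorem twistProd_singleton {i : B} (h : θ (cs.simple i) ≠ cs.simple i) :
    twistProd cs θ [i] = θ (cs.simple i) * cs.simple i := by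
  have : θ (cs.simple i) * cs.simple i ≠ 1 := by
    rwa [Ne, mul_eq_one_iff_eq_inv, cs.inv_simple]
  simp [twistProd, twistAct, this]

theorem twistRank_eq_one {i : B} (h : θ (cs.simple i) ≠ cs.simple i) :
    twistRank cs θ (θ (cs.simple i) * cs.simple i) = 1 := by
  have hmem : 1 ∈ {k | ∃ l : List B, l.length = k ∧
      twistProd cs θ l = θ (cs.simple i) * cs.simple i} :=
    ⟨[i], rfl, twistProd_singleton cs θ h⟩
  have hle : twistRank cs θ (θ (cs.simple i) * cs.simple i) ≤ 1 := Nat.sInf_le hmem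
  have hne : twistRank cs θ (θ (cs.simple i) * cs.simple i) ≠ 0 := by
    intro h0
    obtain ⟨l, hl, e⟩ := mem_of_sInf_eq ⟨1, hmem⟩ h0
    rw [List.length_eq_zero_iff.mp hl] at e
    apply h
    rw [← cs.inv_simple i, map_inv, cs.inv_simple, inv_eq_iff_mul_eq_one]
    exact e.symm
  omega

theorem finite_twistRank_eq_one [Finite B] : {w | twistRank cs θ w = 1}.Finite := by
  refine (Set.finite_range fun i : B => twistProd cs θ [i]).subset fun w hw => ?_
  obtain ⟨l, hl, e⟩ := mem_of_sInf_eq (Nat.nonempty_of_sInf_eq_succ hw) hw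
  obtain ⟨i, rfl⟩ := List.length_eq_one_iff.mp hl
  exact ⟨i, e⟩

/-- The linear coefficient of the factorization `Poin(W) = Poin(ι(θ)) Poin(Fix(θ))`. -/
theorem ncard_range_simple (h : poinW cs = poinIota cs θ * poinFix cs θ) :
    (Set.range cs.simple).ncard =
      {w | w ∈ twistedIdentities θ ∧ twistRank cs θ w = 1}.ncard +
        {w | θ w = w ∧ fixLength cs θ w = 1}.ncard := by
  have h₀ := congrArg (PowerSeries.coeff 0) h
  have h₁ := congrArg (PowerSeries.coeff 1) h
  rw [PowerSeries.coeff_mul] at h₀ h₁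
  simp only [Finset.Nat.antidiagonal_succ, Finset.Nat.antidiagonal_zero, poinW, poinIota, poinFix,
    PowerSeries.coeff_mk, Finset.sum_singleton, Finset.map_singleton, Finset.sum_cons] at h₀ h₁
  have hone : Nat.card {w : W // cs.length w = 0} = 1 := by simp [cs.length_eq_zero_iff]
  rw [hone, eq_comm, mul_eq_one] at h₀
  have hS : Set.range cs.simple = {w | cs.length w = 1} := by
    ext w
    simp [cs.length_eq_one_iff, eq_comm]
  rw [hS]
  simp only [← Nat.card_coe_set_eq, Set.coe_ofPred]
  simp [h₀.1, h₀.2] at h₁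
  omega

/-- The longest element of a finite parabolic subgroup generated by `s` and `θ(s)` is a
fixed point of length one. -/
theorem exists_longest (hθ : Function.Involutive θ)
    (hθS : ∀ i : B, ∃ j : B, θ (cs.simple i) = cs.simple j) (i : B)
    (h : orderOf (cs.simple i * θ (cs.simple i)) ≠ 0) :
    ∃ x ∈ Subgroup.closure ({cs.simple i, θ (cs.simple i)} : Set W),
      (∀ y ∈ Subgroup.closure ({cs.simple i, θ (cs.simple i)} : Set W),
        cs.length y ≤ cs.length x) ∧ θ x = x ∧ fixLength cs θ x = 1 := by
  obtain ⟨j, hj⟩ := hθS i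
  have hfin : (Subgroup.closure ({cs.simple i, θ (cs.simple i)} : Set W) : Set W).Finite := by
    rw [hj] at h ⊢
    exact finite_closure_pair cs h
  obtain ⟨x, hx, hmax⟩ := Set.exists_max_image _ cs.length hfin ⟨1, one_mem _⟩
  have hx1 : x ≠ 1 := by
    rintro rfl
    have := hmax (cs.simple i) (Subgroup.subset_closure (by simp))
    simp at this
  refine ⟨x, hx, hmax, ?_, fixLength_eq_one cs θ ⟨i, hfin, hx, hmax⟩ hx1⟩
  rw [hj] at hx hmax
  exact map_eq_self_of_longest cs θ hj (by rw [← hj, hθ]) hx hmax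

theorem isRightDescent_of_longest {i : B} {t x : W}
    (hx : x ∈ Subgroup.closure ({cs.simple i, t} : Set W))
    (hmax : ∀ y ∈ Subgroup.closure ({cs.simple i, t} : Set W), cs.length y ≤ cs.length x) :
    cs.IsRightDescent x i :=
  lt_of_le_of_ne (hmax _ (mul_mem hx (Subgroup.subset_closure (by simp))))
    (cs.length_mul_simple_ne x i)

theorem simple_eq_of_map_mul_eq (hθS : ∀ i : B, ∃ j : B, θ (cs.simple i) = cs.simple j) {i k : B}
    (hi : θ (cs.simple i) ≠ cs.simple i)
    (h : θ (cs.simple i) * cs.simple i = θ (cs.simple k) * cs.simple k) :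
    cs.simple k = cs.simple i ∨ cs.simple k = θ (cs.simple i) := by
  obtain ⟨j, hj⟩ := hθS i
  obtain ⟨l, hl⟩ := hθS k
  have e : cs.wordProd [l, j, i] = cs.simple k := by
    rw [hj, hl] at h
    simp [cs.wordProd_cons, h]
  obtain ⟨m, hm, e'⟩ := exists_mem_of_wordProd_eq_simple cs e
  simp only [List.mem_cons, List.not_mem_nil, or_false] at hm
  rcases hm with rfl | rfl | rfl
  · rw [hl, ← e', cs.simple_mul_simple_self, mul_eq_one_iff_eq_inv, cs.inv_simple] at h
    exact (hi h).elim
  · exact Or.inr (by rw [e', hj])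
  · exact Or.inl e'

end LinearCoefficient

theorem statement16 [Finite B] (cs : CoxeterSystem M W) (θ : W ≃* W)
    (hθ : Function.Involutive θ)
    (hθS : ∀ i : B, ∃ j : B, θ (cs.simple i) = cs.simple j)
    (h : poinW cs = poinIota cs θ * poinFix cs θ) :
    ∀ i : B, orderOf (cs.simple i * θ (cs.simple i)) = 1 ∨
      orderOf (cs.simple i * θ (cs.simple i)) = 2 ∨
      orderOf (cs.simple i * θ (cs.simple i)) = 0 := by
  set S := Set.range cs.simple with hS
  have hSfin : S.Finite := Set.finite_range _
  obtain ⟨e, he⟩ := Set.countable_iff_exists_injOn.mp hSfin.countable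
  have hθmem {s : W} (hs : s ∈ S) : θ s ∈ S := by
    obtain ⟨i, rfl⟩ := hs
    obtain ⟨j, hj⟩ := hθS i
    exact ⟨j, hj.symm⟩
  have horder (s : W) : orderOf (θ s * θ (θ s)) = orderOf (s * θ s) := by
    rw [← map_mul]
    exact orderOf_injective θ.toMonoidHom θ.injective _
  have hlongest (s : W) : ∃ x : W, s ∈ S → orderOf (s * θ s) ≠ 0 →
      x ∈ Subgroup.closure ({s, θ s} : Set W) ∧
      (∀ y ∈ Subgroup.closure ({s, θ s} : Set W), cs.length y ≤ cs.length x) ∧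
      θ x = x ∧ fixLength cs θ x = 1 := by
    by_cases hs : s ∈ S ∧ orderOf (s * θ s) ≠ 0
    · obtain ⟨⟨i, rfl⟩, h0⟩ := hs
      obtain ⟨x, hx⟩ := exists_longest cs θ hθ hθS i h0
      exact ⟨x, fun _ _ => hx⟩
    · exact ⟨1, fun h₁ h₂ => (hs ⟨h₁, h₂⟩).elim⟩
  choose f hf using hlongest
  -- One representative in each `θ`-orbit for which the product has finite order.
  set F : Set W := {s | s ∈ S ∧ orderOf (s * θ s) ≠ 0 ∧ e s ≤ e (θ s)} with hF
  set A : Set W := {s | s ∈ F ∧ (orderOf (s * θ s) = 1 ∨ orderOf (s * θ s) = 2)} with hA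
  have hFS : F ⊆ S := fun s hs => hs.1
  have hAF : A ⊆ F := fun s hs => hs.1
  have hFcard : F.ncard ≤ {w | θ w = w ∧ fixLength cs θ w = 1}.ncard := by
    refine Set.ncard_le_ncard_of_injOn f (fun s hs => (hf s hs.1 hs.2.1).2.2) ?_
      ((finite_canonicalGens cs θ).subset
        fun w hw => mem_canonicalGens_of_fixLength_eq_one cs θ hw.2)
    rintro s ⟨⟨i, rfl⟩, hs0, hse⟩ t ⟨⟨k, rfl⟩, ht0, hte⟩ hst
    obtain ⟨hx, -⟩ := hf _ ⟨i, rfl⟩ hs0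
    obtain ⟨hy, hymax, -⟩ := hf _ ⟨k, rfl⟩ ht0
    have hk := isRightDescent_of_longest cs hy hymax
    rw [← hst] at hk
    obtain ⟨j, hj⟩ := hθS i
    rw [hj] at hx
    rcases simple_eq_of_isRightDescent cs hx hk with h' | h'
    · exact h'.symm
    · rw [h', ← hj, hθ] at hte
      rw [h', ← hj]
      exact he ⟨i, rfl⟩ (hθmem ⟨i, rfl⟩) (hse.antisymm hte)
  have hK : (S \ A).ncard ≤ {w | w ∈ twistedIdentities θ ∧ twistRank cs θ w = 1}.ncard := by
    have hne {s : W} (hs : s ∈ S \ A) : θ s ≠ s := by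
      obtain ⟨⟨i, rfl⟩, hsA⟩ := hs
      intro hfix
      exact hsA ⟨⟨⟨i, rfl⟩, by simp [hfix], by rw [hfix]⟩, by simp [hfix]⟩
    refine Set.ncard_le_ncard_of_injOn (fun s => θ s * s) (fun s hs => ?_) ?_
      ((finite_twistRank_eq_one cs θ).subset fun w hw => hw.2)
    · have hns := hne hs
      obtain ⟨⟨i, rfl⟩, -⟩ := hs
      exact ⟨⟨cs.simple i, by simp⟩, twistRank_eq_one cs θ hns⟩
    · intro s hs t ht hst
      have hns := hne hs
      obtain ⟨⟨i, rfl⟩, hsA⟩ := hs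
      obtain ⟨⟨k, rfl⟩, htA⟩ := ht
      rcases simple_eq_of_map_mul_eq cs θ hθS hns hst with h' | h'
      · exact h'.symm
      have hcomm : θ (cs.simple i) * cs.simple i = cs.simple i * θ (cs.simple i) := by
        simpa [h', hθ (cs.simple i)] using hst
      have h2 : orderOf (cs.simple i * θ (cs.simple i)) = 2 := by
        refine orderOf_eq_prime ?_ fun h1 => hns ?_
        · rw [pow_two]
          nth_rw 1 [← hcomm]
          rw [mul_assoc, cs.simple_mul_simple_cancel_left, ← map_mul, cs.simple_mul_simple_self,
            map_one]
        · rw [← cs.inv_simple i, map_inv, cs.inv_simple, inv_eq_iff_mul_eq_one, hcomm, h1]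
      rcases le_total (e (cs.simple i)) (e (θ (cs.simple i))) with hle | hle
      · exact (hsA ⟨⟨⟨i, rfl⟩, by simp [h2], hle⟩, Or.inr h2⟩).elim
      · refine (htA ⟨⟨⟨k, rfl⟩, ?_, ?_⟩, Or.inr ?_⟩).elim
        · rw [h', horder]; simp [h2]
        · rwa [h', hθ]
        · rw [h', horder, h2]
  have hcard := ncard_range_simple cs θ h
  have hdiff := Set.ncard_sdiff_add_ncard_of_subset (hAF.trans hFS) hSfin
  have hFA : F = A :=
    (Set.eq_of_subset_of_ncard_le hAF (by rw [← hS] at hcard; omega) (hSfin.subset hFS)).symm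
  intro i
  by_cases h0 : orderOf (cs.simple i * θ (cs.simple i)) = 0
  · exact Or.inr (Or.inr h0)
  rw [← or_assoc]
  left
  rcases le_total (e (cs.simple i)) (e (θ (cs.simple i))) with hle | hle
  · have : cs.simple i ∈ A := hFA ▸ ⟨⟨i, rfl⟩, h0, hle⟩
    exact this.2
  · have : θ (cs.simple i) ∈ A :=
      hFA ▸ ⟨hθmem ⟨i, rfl⟩, by rwa [horder], by rwa [hθ]⟩
    rw [← horder]
    exact this.2

end TwistedIdentitiesPaper
end
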